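/- arXiv:1912.02886 — 8 statements merged into one kernel-verified Lean document; each statement's English description precedes it below -/
import Mathlib

section
/- Let n be a positive integer, let p be a real with 0 ≤ p ≤ 1, and let a_1, …, a_n be nonzero reals. Then for every x ∈ ℝ, P(a; p; x) ≤ max over integers ℓ with 0 ≤ ℓ ≤ n and integers y with −(n−ℓ) ≤ y ≤ ℓ of D(ℓ, n−ℓ, p, y). In other words, the point probability of X = Σ a_i ξ_i is at most the maximum point probability achievable when every coefficient a_i is 1 or −1. -/
open Finset

/-- `P n a p x` is the probability that `∑ i, a i * ξ i = x` where the `ξ i` are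
i.i.d. Bernoulli(p): the sum over subsets `S` with `∑_{i ∈ S} a i = x` of
`p^|S| (1-p)^(n-|S|)`. -/
noncomputable def P (n : ℕ) (a : Fin n → ℝ) (p : ℝ) (x : ℝ) : ℝ :=
  ∑ S : Finset (Fin n),
    if (∑ i ∈ S, a i) = x then p ^ S.card * (1 - p) ^ (n - S.card) else 0

/-- `D ℓ m p y` is the probability that `Bin(ℓ,p) - Bin(m,p) = y` for independent
binomials. -/
noncomputable def D (ℓ m : ℕ) (p : ℝ) (y : ℤ) : ℝ :=
  ∑ k ∈ Finset.range (ℓ + 1), ∑ j ∈ Finset.range (m + 1),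
    if (k : ℤ) - (j : ℤ) = y then
      (ℓ.choose k : ℝ) * (m.choose j : ℝ) * p ^ (k + j) * (1 - p) ^ ((ℓ - k) + (m - j))
    else 0

/-- The partial sum, over the points `(i, i - y)` with `0 ≤ i ≤ k`, of the product weight `u ⊗ v`. -/
noncomputable def diagSum (u v : ℤ → ℝ) (y k : ℤ) : ℝ :=
  ∑ i ∈ Icc 0 k, u i * v (i - y)

/-- Log-concavity without internal zeros of a sequence indexed by `ℤ`. -/
def IsPF2 (u : ℤ → ℝ) : Prop :=
  ∀ a b c d : ℤ, a ≤ b → a ≤ c → a + d = b + c → u a * u d ≤ u b * u c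

section DiagSum

variable {u v : ℤ → ℝ}

theorem diagSum_mono (hu : ∀ z, 0 ≤ u z) (hv : ∀ z, 0 ≤ v z) (y : ℤ) {k K : ℤ} (h : k ≤ K) :
    diagSum u v y k ≤ diagSum u v y K :=
  sum_le_sum_of_subset_of_nonneg (Icc_subset_Icc_right h)
    fun _ _ _ => mul_nonneg (hu _) (hv _)

theorem diagSum_nonneg (hu : ∀ z, 0 ≤ u z) (hv : ∀ z, 0 ≤ v z) (y k : ℤ) :
    0 ≤ diagSum u v y k :=
  sum_nonneg fun _ _ => mul_nonneg (hu _) (hv _)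

theorem diagSum_eq_of_le {L : ℤ} (hL : ∀ z, L < z → u z = 0) (y : ℤ) {K : ℤ} (h : L ≤ K) :
    diagSum u v y K = diagSum u v y L := by
  refine (sum_subset (Icc_subset_Icc_right h) fun i hi hi' => ?_).symm
  rw [mem_Icc] at hi hi'
  rw [hL i (by omega), zero_mul]

theorem diagSum_swap (hu : ∀ z, z < 0 → u z = 0) (hv : ∀ z, z < 0 → v z = 0) (y k : ℤ) :
    diagSum v u (-y) (k - y) = diagSum u v y k := by
  have key : ∀ (f g : ℤ → ℝ) (i : ℤ), (∀ z, z < 0 → g z = 0) → f i * g (i - y) ≠ 0 →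
      0 ≤ i - y := by
    intro f g i hg h
    by_contra! hlt
    exact h (by rw [hg _ hlt, mul_zero])
  refine sum_bij_ne_zero (fun i _ _ => i + y) ?_ ?_ ?_ ?_
  · intro i hi h
    rw [mem_Icc] at hi ⊢
    have : 0 ≤ i + y := by
      by_contra! hlt
      exact h (by rw [hu _ (by omega), mul_zero])
    omega
  · intro i _ _ j _ _ h
    omega
  · intro i hi h
    rw [mem_Icc] at hi
    have := key u v i hv h
    refine ⟨i - y, by rw [mem_Icc]; omega, ?_, by ring⟩
    rw [mul_comm]
    simpa using h
  · intro i _ _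
    simp [mul_comm]

theorem diagSum_succ {k : ℤ} (hk : 0 ≤ k) (y : ℤ) :
    diagSum u v y k = diagSum u v y (k - 1) + u k * v (k - y) := by
  have : Icc 0 k = insert k (Icc 0 (k - 1)) := by
    ext i
    simp only [mem_insert, mem_Icc]
    omega
  rw [diagSum, this, sum_insert (by simp), add_comm, diagSum]

theorem diagSum_mul_le (hu : ∀ z, 0 ≤ u z) (hv : IsPF2 v) {y y' k K : ℤ}
    (hy : y ≤ y') (hk : k ≤ K) :
    diagSum u v y' k * diagSum u v y K ≤ diagSum u v y k * diagSum u v y' K := by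
  rcases lt_or_ge k 0 with hneg | hpos
  · simp [diagSum, Icc_eq_empty_of_lt hneg]
  have split : ∀ z, diagSum u v z K = diagSum u v z k + ∑ i ∈ Ioc k K, u i * v (i - z) := by
    intro z
    have hd : Disjoint (Icc 0 k) (Ioc k K) := by
      rw [disjoint_left]
      intro i hi hi'
      rw [mem_Icc] at hi
      rw [mem_Ioc] at hi'
      omega
    rw [diagSum, diagSum, ← sum_union hd]
    congr 1
    ext i
    simp only [mem_union, mem_Icc, mem_Ioc]
    omega
  have tail : diagSum u v y' k * ∑ i ∈ Ioc k K, u i * v (i - y) ≤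
      diagSum u v y k * ∑ i ∈ Ioc k K, u i * v (i - y') := by
    rw [diagSum, diagSum, sum_mul_sum, sum_mul_sum]
    refine sum_le_sum fun i hi => sum_le_sum fun j hj => ?_
    rw [mem_Icc] at hi
    rw [mem_Ioc] at hj
    have h := hv (i - y') (i - y) (j - y') (j - y) (by omega) (by omega) (by ring)
    calc u i * v (i - y') * (u j * v (j - y))
        = u i * u j * (v (i - y') * v (j - y)) := by ring
      _ ≤ u i * u j * (v (i - y) * v (j - y')) :=
          mul_le_mul_of_nonneg_left h (mul_nonneg (hu i) (hu j))
      _ = u i * v (i - y) * (u j * v (j - y')) := by ring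
  rw [split y, split y']
  linarith

/-- The normalized distribution functions along the diagonals are compatible with the strict
product order. -/
theorem diagSum_div_le {L : ℤ} (hu : ∀ z, 0 ≤ u z) (hv : ∀ z, 0 ≤ v z)
    (hu' : IsPF2 u) (hv' : IsPF2 v) (hu0 : ∀ z, z < 0 → u z = 0) (hv0 : ∀ z, z < 0 → v z = 0)
    (hL : ∀ z, L < z → u z = 0) {k j k' j' : ℤ} (hk : k' < k) (hj : j' < j) (hkL : k' ≤ L)
    (hC : 0 < diagSum u v (k - j) L) (hC' : 0 < diagSum u v (k' - j') L) :
    diagSum u v (k' - j') k' / diagSum u v (k' - j') L ≤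
      diagSum u v (k - j) (k - 1) / diagSum u v (k - j) L := by
  rw [div_le_div_iff₀ hC' hC]
  rcases le_total (k - j) (k' - j') with h | h
  · exact (diagSum_mul_le hu hv' h hkL).trans
      (mul_le_mul_of_nonneg_right (diagSum_mono hu hv _ (by omega)) hC'.le)
  · set y := k - j with hy
    set y' := k' - j' with hy'
    set J := max j' (max (L - y) (L - y')) with hJ
    have h1 : L - y ≤ J := (le_max_left _ _).trans (le_max_right _ _)
    have h2 : L - y' ≤ J := (le_max_right _ _).trans (le_max_right _ _)
    have h3 := diagSum_mul_le (y := -y) (y' := -y') (k := j') (K := J) hv hu' (by omega)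
      (le_max_left _ _)
    have e : ∀ z i, diagSum v u (-z) i = diagSum u v z (i + z) := by
      intro z i
      rw [← diagSum_swap hu0 hv0, add_sub_cancel_right]
    rw [e, e, e, e, diagSum_eq_of_le hL y (K := J + y) (by omega),
      diagSum_eq_of_le hL y' (K := J + y') (by omega)] at h3
    rw [show j' + y' = k' by omega] at h3
    exact h3.trans (mul_le_mul_of_nonneg_right (diagSum_mono hu hv _ (by omega)) hC'.le)

theorem sum_div_diagSum_le {L : ℤ} (hu : ∀ z, 0 ≤ u z) (hv : ∀ z, 0 ≤ v z)
    (hu' : IsPF2 u) (hv' : IsPF2 v) (hu0 : ∀ z, z < 0 → u z = 0) (hv0 : ∀ z, z < 0 → v z = 0)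
    (hL : ∀ z, L < z → u z = 0) (A : Finset (ℤ × ℤ))
    (hA : ∀ a ∈ A, ∀ b ∈ A, a.1 ≤ b.1 → b.2 ≤ a.2 → a = b)
    (hbox : ∀ a ∈ A, 0 ≤ a.1 ∧ a.1 ≤ L)
    (hpos : ∀ a ∈ A, 0 < diagSum u v (a.1 - a.2) L) (R : ℝ) (hR : 0 ≤ R)
    (hAR : ∀ a ∈ A, diagSum u v (a.1 - a.2) a.1 / diagSum u v (a.1 - a.2) L ≤ R) :
    ∑ a ∈ A, u a.1 * v a.2 / diagSum u v (a.1 - a.2) L ≤ R := by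
  induction A using Finset.induction_on_max_value (Prod.fst : ℤ × ℤ → ℤ) generalizing R with
  | empty => simpa using hR
  | insert b s hb hmax ih =>
    have hbm := mem_insert_self b s
    have hsub : ∀ a ∈ s, a ∈ insert b s := fun a ha => mem_insert_of_mem ha
    have hprev := ih (fun a ha c hc => hA a (hsub a ha) c (hsub c hc))
      (fun a ha => hbox a (hsub a ha)) (fun a ha => hpos a (hsub a ha))
      (diagSum u v (b.1 - b.2) (b.1 - 1) / diagSum u v (b.1 - b.2) L)
      (div_nonneg (diagSum_nonneg hu hv _ _) (diagSum_nonneg hu hv _ _)) (by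
        intro a ha
        have hne : a ≠ b := fun h => hb (h ▸ ha)
        have h1 := hmax a ha
        have h2 : a.2 < b.2 := by
          by_contra! h
          exact hne (hA a (hsub a ha) b hbm h1 h)
        have h3 : a.1 < b.1 := by
          by_contra! h
          exact hne (hA b hbm a (hsub a ha) h h2.le).symm
        exact diagSum_div_le hu hv hu' hv' hu0 hv0 hL h3 h2 (hbox a (hsub a ha)).2
          (hpos b hbm) (hpos a (hsub a ha)))
    have hlast := hAR b hbm
    rw [diagSum_succ (hbox b hbm).1, sub_sub_cancel, add_div] at hlast
    rw [sum_insert hb]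
    linarith

/-- A weighted antichain in a product of two chains with log-concave weights has weight at most
that of some layer it meets. -/
theorem sum_mul_le_of_diagSum_le {L : ℤ} (hu : ∀ z, 0 ≤ u z) (hv : ∀ z, 0 ≤ v z)
    (hu' : IsPF2 u) (hv' : IsPF2 v) (hu0 : ∀ z, z < 0 → u z = 0) (hv0 : ∀ z, z < 0 → v z = 0)
    (hL : ∀ z, L < z → u z = 0) (A : Finset (ℤ × ℤ))
    (hA : ∀ a ∈ A, ∀ b ∈ A, a.1 ≤ b.1 → b.2 ≤ a.2 → a = b)
    (hbox : ∀ a ∈ A, 0 ≤ a.1 ∧ a.1 ≤ L) {M : ℝ} (hM0 : 0 ≤ M)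
    (hM : ∀ a ∈ A, diagSum u v (a.1 - a.2) L ≤ M) :
    ∑ a ∈ A, u a.1 * v a.2 ≤ M := by
  classical
  have hne : ∑ a ∈ A with u a.1 * v a.2 ≠ 0, u a.1 * v a.2 = ∑ a ∈ A, u a.1 * v a.2 :=
    sum_filter_ne_zero A
  rw [← hne]
  set B := A.filter fun a => u a.1 * v a.2 ≠ 0 with hB
  have hBA : ∀ a ∈ B, a ∈ A := fun a ha => (mem_filter.1 ha).1
  have hpos : ∀ a ∈ B, 0 < diagSum u v (a.1 - a.2) L := by
    intro a ha
    have h0 : 0 < u a.1 * v a.2 :=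
      lt_of_le_of_ne (mul_nonneg (hu _) (hv _)) (mem_filter.1 ha).2.symm
    refine h0.trans_le ?_
    have := single_le_sum (f := fun i => u i * v (i - (a.1 - a.2))) (s := Icc 0 L)
      (fun i _ => mul_nonneg (hu _) (hv _)) (mem_Icc.2 (hbox a (hBA a ha)))
    simpa [diagSum] using this
  have h1 := sum_div_diagSum_le hu hv hu' hv' hu0 hv0 hL B
    (fun a ha b hb => hA a (hBA a ha) b (hBA b hb)) (fun a ha => hbox a (hBA a ha)) hpos 1
    zero_le_one (fun a ha => div_le_one_of_le₀
      (diagSum_mono hu hv _ (hbox a (hBA a ha)).2) (hpos a ha).le)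
  calc ∑ a ∈ B, u a.1 * v a.2
      ≤ ∑ a ∈ B, M * (u a.1 * v a.2 / diagSum u v (a.1 - a.2) L) := by
        refine sum_le_sum fun a ha => ?_
        rw [← mul_div_assoc, le_div_iff₀ (hpos a ha), mul_comm M]
        exact mul_le_mul_of_nonneg_left (hM a (hBA a ha)) (mul_nonneg (hu _) (hv _))
    _ = M * ∑ a ∈ B, u a.1 * v a.2 / diagSum u v (a.1 - a.2) L := by rw [mul_sum]
    _ ≤ M * 1 := mul_le_mul_of_nonneg_left h1 hM0
    _ = M := mul_one M

end DiagSum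

/-- The probability mass function of `Bin(m, p)`, extended by zero to `ℤ`. -/
noncomputable def binWeight (p : ℝ) : ℕ → ℤ → ℝ
  | 0, z => if z = 0 then 1 else 0
  | m + 1, z => (1 - p) * binWeight p m z + p * binWeight p m (z - 1)

section BinWeight

variable {p : ℝ}

theorem binWeight_nonneg (hp0 : 0 ≤ p) (hp1 : p ≤ 1) (m : ℕ) (z : ℤ) : 0 ≤ binWeight p m z := by
  induction m generalizing z with
  | zero =>
    rw [binWeight]
    split_ifs <;> norm_num
  | succ m ih =>
    rw [binWeight]
    have := ih z
    have := ih (z - 1)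
    have : 0 ≤ 1 - p := by linarith
    positivity

theorem binWeight_of_neg (p : ℝ) (m : ℕ) (z : ℤ) (hz : z < 0) : binWeight p m z = 0 := by
  induction m generalizing z with
  | zero => rw [binWeight, if_neg hz.ne]
  | succ m ih => rw [binWeight, ih z hz, ih (z - 1) (by omega)]; ring

theorem binWeight_of_lt (p : ℝ) (m : ℕ) (z : ℤ) (hz : (m : ℤ) < z) : binWeight p m z = 0 := by
  induction m generalizing z with
  | zero => rw [binWeight, if_neg (by simpa using hz.ne')]
  | succ m ih =>
    push_cast at hz
    rw [binWeight, ih z (by omega), ih (z - 1) (by omega)]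
    ring

theorem binWeight_natCast (p : ℝ) (m j : ℕ) :
    binWeight p m j = m.choose j * (p ^ j * (1 - p) ^ (m - j)) := by
  induction m generalizing j with
  | zero => cases j <;> simp [binWeight]; omega
  | succ m ih =>
    rw [binWeight, ih]
    cases j with
    | zero =>
      rw [binWeight_of_neg p m _ (by simp)]
      simp [pow_succ']
    | succ j =>
      rw [show ((j + 1 : ℕ) : ℤ) - 1 = (j : ℤ) by push_cast; ring, ih, Nat.choose_succ_succ,
        Nat.add_sub_add_right]
      push_cast
      rcases lt_or_ge j m with h | h
      · rw [show m - j = m - (j + 1) + 1 by omega]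
        ring
      · rw [Nat.choose_eq_zero_of_lt (by omega : m < j + 1)]
        push_cast
        ring

theorem isPF2_of_le {u : ℤ → ℝ} (h : ∀ a b c d : ℤ, a < b → b ≤ c → a + d = b + c →
    u a * u d ≤ u b * u c) : IsPF2 u := by
  intro a b c d hab hac he
  rcases hab.eq_or_lt with rfl | hab
  · rw [show d = c by omega]
  rcases hac.eq_or_lt with rfl | hac
  · rw [show d = b by omega, mul_comm]
  rcases le_total b c with hbc | hbc
  · exact h a b c d hab hbc he
  · rw [mul_comm (u b)]
    exact h a c b d hac hbc (by omega)

theorem isPF2_binWeight (hp0 : 0 ≤ p) (hp1 : p ≤ 1) (m : ℕ) : IsPF2 (binWeight p m) := by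
  induction m with
  | zero =>
    refine isPF2_of_le fun a b c d hab hbc he => ?_
    have : binWeight p 0 a * binWeight p 0 d = 0 := by
      simp only [binWeight]
      split_ifs <;> first | omega | simp
    rw [this]
    exact mul_nonneg (binWeight_nonneg hp0 hp1 _ _) (binWeight_nonneg hp0 hp1 _ _)
  | succ m ih =>
    refine isPF2_of_le fun a b c d hab hbc he => ?_
    have hq : 0 ≤ 1 - p := by linarith
    have h1 := ih a b c d (by omega) (by omega) he
    have h2 := ih (a - 1) (b - 1) (c - 1) (d - 1) (by omega) (by omega) (by omega)
    have h3 := ih (a - 1) (b - 1) c d (by omega) (by omega) (by omega)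
    have h4 := ih a b (c - 1) (d - 1) (by omega) (by omega) (by omega)
    simp only [binWeight]
    have h1' := mul_le_mul_of_nonneg_left h1 (mul_nonneg hq hq)
    have h2' := mul_le_mul_of_nonneg_left h2 (mul_nonneg hp0 hp0)
    have h3' := mul_le_mul_of_nonneg_left h3 (mul_nonneg hp0 hq)
    have h4' := mul_le_mul_of_nonneg_left h4 (mul_nonneg hp0 hq)
    linarith

theorem diagSum_binWeight (p : ℝ) (ℓ m : ℕ) (y : ℤ) :
    diagSum (binWeight p ℓ) (binWeight p m) y ℓ = D ℓ m p y := by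
  rw [diagSum, D]
  have himg : Icc (0 : ℤ) ℓ = (range (ℓ + 1)).image (fun k : ℕ => (k : ℤ)) := by
    ext i
    simp only [mem_Icc, mem_image, mem_range]
    constructor
    · rintro ⟨h0, h1⟩
      exact ⟨i.toNat, by omega, by omega⟩
    · rintro ⟨k, hk, rfl⟩
      omega
  rw [himg, sum_image (fun _ _ _ _ h => Nat.cast_injective h)]
  refine sum_congr rfl fun k _ => ?_
  by_cases h : ∃ j ∈ range (m + 1), (k : ℤ) - (j : ℤ) = y
  · obtain ⟨j, hj, rfl⟩ := h
    rw [sum_eq_single_of_mem j hj (fun i _ hi => if_neg (by omega)), if_pos rfl,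
      sub_sub_cancel, binWeight_natCast, binWeight_natCast, pow_add, pow_add]
    ring
  · push Not at h
    rw [sum_eq_zero fun j hj => if_neg (h j hj)]
    rcases lt_or_ge ((k : ℤ) - y) 0 with h0 | h0
    · rw [binWeight_of_neg p m _ h0, mul_zero]
    rcases lt_or_ge (m : ℤ) ((k : ℤ) - y) with h1 | h1
    · rw [binWeight_of_lt p m _ h1, mul_zero]
    exact absurd (by omega) (h ((k : ℤ) - y).toNat (by rw [mem_range]; omega))

end BinWeight

section Chains

variable {α : Type*} [Fintype α] [DecidableEq α]

theorem exists_perm_map_eq {S T : Finset α} (h : S.card = T.card) :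
    ∃ σ : Equiv.Perm α, S.map σ.toEmbedding = T := by
  have e : {x // x ∈ S} ≃ {x // x ∈ T} := S.equivOfCardEq h
  refine ⟨e.extendSubtype, ?_⟩
  refine eq_of_subset_of_card_le ?_ (by rw [card_map, h])
  intro y hy
  obtain ⟨x, hx, rfl⟩ := mem_map.1 hy
  exact e.extendSubtype_mem x hx

/-- Averaging over the images of a fixed set under all permutations. -/
theorem choose_mul_sum_perm (f : Finset α → ℝ) (S : Finset α) :
    ((Fintype.card α).choose S.card : ℝ) * ∑ σ : Equiv.Perm α, f (S.map σ.toEmbedding) =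
      Fintype.card (Equiv.Perm α) * ∑ T ∈ powersetCard S.card univ, f T := by
  have horb : ∀ T ∈ powersetCard S.card (univ : Finset α),
      ∑ σ : Equiv.Perm α, f (T.map σ.toEmbedding) =
        ∑ σ : Equiv.Perm α, f (S.map σ.toEmbedding) := by
    intro T hT
    obtain ⟨τ, rfl⟩ := exists_perm_map_eq (mem_powersetCard.1 hT).2.symm
    refine Fintype.sum_equiv (Equiv.mulRight τ) _ _ fun σ => ?_
    rw [map_map]
    rfl
  have hinv : ∀ σ : Equiv.Perm α, ∑ T ∈ powersetCard S.card univ, f (T.map σ.toEmbedding) =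
      ∑ T ∈ powersetCard S.card (univ : Finset α), f T := by
    intro σ
    refine sum_bij (fun T _ => T.map σ.toEmbedding) ?_ ?_ ?_ (fun _ _ => rfl)
    · intro T hT
      simpa [mem_powersetCard] using hT
    · intro T _ T' _ h
      exact map_injective _ h
    · intro T hT
      refine ⟨T.map σ.symm.toEmbedding, by simpa [mem_powersetCard] using hT, ?_⟩
      rw [map_map]
      convert map_refl
      ext x
      simp
  calc ((Fintype.card α).choose S.card : ℝ) * ∑ σ : Equiv.Perm α, f (S.map σ.toEmbedding)
      = ∑ T ∈ powersetCard S.card (univ : Finset α),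
          ∑ σ : Equiv.Perm α, f (T.map σ.toEmbedding) := by
        rw [sum_congr rfl horb, sum_const, card_powersetCard, card_univ, nsmul_eq_mul]
    _ = _ := by
        rw [sum_comm, sum_congr rfl fun σ _ => hinv σ, sum_const, card_univ, nsmul_eq_mul]

/-- Some maximal chain carries at least the average of a weighted sum over all subsets. -/
theorem exists_chain_sum_le (f : Finset α → ℝ) (g : ℕ → ℝ) :
    ∃ c : ℕ → Finset α, Monotone c ∧ (∀ k ≤ Fintype.card α, (c k).card = k) ∧
      ∑ S : Finset α, g S.card * f S ≤
        ∑ k ∈ range (Fintype.card α + 1), (Fintype.card α).choose k * g k * f (c k) := by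
  set N := Fintype.card α with hN
  let e : α ≃ Fin N := Fintype.equivFin α
  let c : ℕ → Finset α := fun k => univ.filter fun i => (e i : ℕ) < k
  have hmono : Monotone c := by
    intro k k' hk i hi
    simp only [c, mem_filter, mem_univ, true_and] at hi ⊢
    omega
  have hcard : ∀ k ≤ N, (c k).card = k := by
    intro k hk
    have : (c k).map e.toEmbedding = univ.filter fun i : Fin N => (i : ℕ) < k := by
      ext i
      simp [c]
    rw [← card_map e.toEmbedding, this, Fin.card_filter_val_lt]
    omega
  have hlayers : ∑ S : Finset α, g S.card * f S =
      ∑ k ∈ range (N + 1), g k * ∑ S ∈ powersetCard k univ, f S := by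
    rw [← powerset_univ, sum_powerset, card_univ]
    refine sum_congr rfl fun k _ => ?_
    rw [mul_sum]
    refine sum_congr rfl fun S hS => ?_
    rw [(mem_powersetCard.1 hS).2]
  have havg : ∑ σ : Equiv.Perm α, ∑ S : Finset α, g S.card * f S = ∑ σ : Equiv.Perm α,
      ∑ k ∈ range (N + 1), N.choose k * g k * f ((c k).map σ.toEmbedding) := by
    rw [sum_comm (s := (univ : Finset (Equiv.Perm α))) (t := range (N + 1)), sum_const, card_univ,
      nsmul_eq_mul, hlayers, mul_sum]
    refine sum_congr rfl fun k hk => ?_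
    have h := choose_mul_sum_perm f (c k)
    rw [hcard k (by rw [mem_range] at hk; omega)] at h
    rw [← mul_sum, mul_assoc, mul_left_comm, mul_left_comm _ (g k), ← h]
  obtain ⟨σ, -, hσ⟩ := exists_le_of_sum_le univ_nonempty havg.le
  refine ⟨fun k => (c k).map σ.toEmbedding, fun k k' h => map_subset_map.2 (hmono h), ?_, hσ⟩
  intro k hk
  rw [card_map, hcard k hk]

end Chains

/-- Two-sided biased Sperner bound: `F` is an antichain for inclusion in the first coordinate and
reverse inclusion in the second. -/
theorem sum_antichain_le {α β : Type*} [Fintype α] [Fintype β] [DecidableEq α] [DecidableEq β]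
    {p : ℝ} (hp0 : 0 ≤ p) (hp1 : p ≤ 1) (F : Finset α → Finset β → Prop)
    [∀ U V, Decidable (F U V)]
    (hF : ∀ U V U' V', F U V → F U' V' → U ⊆ U' → V' ⊆ V → U = U' ∧ V = V') {M : ℝ}
    (hM0 : 0 ≤ M)
    (hM : ∀ k ≤ Fintype.card α, ∀ j ≤ Fintype.card β,
      D (Fintype.card α) (Fintype.card β) p ((k : ℤ) - j) ≤ M) :
    ∑ U : Finset α, ∑ V : Finset β, (p ^ U.card * (1 - p) ^ (Fintype.card α - U.card)) *
      ((p ^ V.card * (1 - p) ^ (Fintype.card β - V.card)) * if F U V then 1 else 0) ≤ M := by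
  set ℓ := Fintype.card α
  set m := Fintype.card β
  obtain ⟨c, hc, hc', hcsum⟩ := exists_chain_sum_le
    (fun U : Finset α => ∑ V : Finset β,
      (p ^ V.card * (1 - p) ^ (m - V.card)) * if F U V then (1 : ℝ) else 0)
    (fun k => p ^ k * (1 - p) ^ (ℓ - k))
  obtain ⟨d, hd, hd', hdsum⟩ := exists_chain_sum_le
    (fun V : Finset β => ∑ k ∈ range (ℓ + 1),
      (ℓ.choose k * (p ^ k * (1 - p) ^ (ℓ - k))) * if F (c k) V then (1 : ℝ) else 0)
    (fun j => p ^ j * (1 - p) ^ (m - j))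
  set A : Finset (ℕ × ℕ) := (range (m + 1) ×ˢ range (ℓ + 1)).filter fun a => F (c a.2) (d a.1)
    with hA
  set B : Finset (ℤ × ℤ) := A.image fun a => ((a.2 : ℤ), (a.1 : ℤ)) with hB
  have hmem : ∀ b ∈ B, ∃ k j : ℕ, b = ((k : ℤ), (j : ℤ)) ∧ k ≤ ℓ ∧ j ≤ m ∧ F (c k) (d j) := by
    intro b hb
    obtain ⟨⟨j, k⟩, ha, rfl⟩ := mem_image.1 hb
    simp only [hA, mem_filter, mem_product, mem_range] at ha
    exact ⟨k, j, rfl, by omega, by omega, ha.2⟩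
  have hfinal := sum_mul_le_of_diagSum_le (L := (ℓ : ℤ)) (binWeight_nonneg hp0 hp1 ℓ)
    (binWeight_nonneg hp0 hp1 m) (isPF2_binWeight hp0 hp1 ℓ) (isPF2_binWeight hp0 hp1 m)
    (binWeight_of_neg p ℓ) (binWeight_of_neg p m) (binWeight_of_lt p ℓ) B
    (by
      intro a ha b hb h1 h2
      obtain ⟨k, j, rfl, hk, hj, hkj⟩ := hmem a ha
      obtain ⟨k', j', rfl, hk', hj', hkj'⟩ := hmem b hb
      simp only [Nat.cast_le] at h1 h2
      obtain ⟨e1, e2⟩ := hF _ _ _ _ hkj hkj' (hc h1) (hd h2)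
      rw [show k = k' by rw [← hc' k hk, ← hc' k' hk', e1],
        show j = j' by rw [← hd' j hj, ← hd' j' hj', e2]])
    (by
      intro a ha
      obtain ⟨k, j, rfl, hk, hj, -⟩ := hmem a ha
      simp only
      omega)
    hM0
    (by
      intro a ha
      obtain ⟨k, j, rfl, hk, hj, -⟩ := hmem a ha
      rw [diagSum_binWeight]
      exact hM k hk j hj)
  refine le_trans (le_of_eq ?_) (hcsum.trans (le_trans (le_of_eq ?_) (hdsum.trans
    (le_trans (le_of_eq ?_) hfinal))))
  · simp only [mul_sum]
  · simp only [mul_sum]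
    rw [sum_comm]
    refine sum_congr rfl fun V _ => sum_congr rfl fun k _ => ?_
    ring
  · rw [hB, sum_image (by
      rintro ⟨j, k⟩ _ ⟨j', k'⟩ _ h
      simp only [Prod.mk.injEq, Nat.cast_inj] at h
      rw [h.1, h.2]), hA, sum_filter, sum_product]
    refine sum_congr rfl fun j _ => ?_
    rw [mul_sum]
    refine sum_congr rfl fun k _ => ?_
    rw [binWeight_natCast, binWeight_natCast]
    split_ifs <;> ring

theorem P_eq_sum_sum (n : ℕ) (a : Fin n → ℝ) (p x : ℝ) (q : Fin n → Prop) [DecidablePred q] :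
    P n a p x = ∑ U : Finset {i // q i}, ∑ V : Finset {i // ¬ q i},
      (p ^ U.card * (1 - p) ^ (Fintype.card {i // q i} - U.card)) *
      ((p ^ V.card * (1 - p) ^ (Fintype.card {i // ¬ q i} - V.card)) *
        if (∑ i ∈ U, a i) + ∑ i ∈ V, a i = x then 1 else 0) := by
  have hn : Fintype.card {i // q i} + Fintype.card {i // ¬ q i} = n := by
    rw [← Fintype.card_sum, Fintype.card_congr (Equiv.sumCompl q), Fintype.card_fin]
  rw [← Fintype.sum_prod_type', P]
  refine (Fintype.sum_equiv
    (Finset.sumEquiv.symm.toEquiv.trans (Equiv.finsetCongr (Equiv.sumCompl q))) _ _ ?_).symm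
  rintro ⟨U, V⟩
  have hU := card_le_univ U
  have hV := card_le_univ V
  have hS : (Finset.sumEquiv.symm.toEquiv.trans (Equiv.finsetCongr (Equiv.sumCompl q))) (U, V) =
      (U.disjSum V).map (Equiv.sumCompl q).toEmbedding := rfl
  have hsum : ∑ i ∈ (U.disjSum V).map (Equiv.sumCompl q).toEmbedding, a i =
      (∑ i ∈ U, a i) + ∑ i ∈ V, a i := by
    simp [sum_map, sum_disjSum]
  rw [hS, card_map, card_disjSum, hsum]
  by_cases h : (∑ i ∈ U, a i) + ∑ i ∈ V, a i = x
  · rw [if_pos h, if_pos h, show n - (U.card + V.card) = (Fintype.card {i // q i} - U.card) +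
      (Fintype.card {i // ¬ q i} - V.card) by omega, pow_add, pow_add]
    ring
  · rw [if_neg h, if_neg h, mul_zero, mul_zero]

theorem D_nonneg {p : ℝ} (hp0 : 0 ≤ p) (hp1 : p ≤ 1) (ℓ m : ℕ) (y : ℤ) : 0 ≤ D ℓ m p y := by
  rw [← diagSum_binWeight]
  exact diagSum_nonneg (binWeight_nonneg hp0 hp1 ℓ) (binWeight_nonneg hp0 hp1 m) y ℓ

theorem eq_of_subset_of_sum_le {ι : Type*} {f : ι → ℝ} {S T : Finset ι} (hf : ∀ i, 0 < f i)
    (hST : S ⊆ T) (h : ∑ i ∈ T, f i ≤ ∑ i ∈ S, f i) : S = T := by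
  by_contra hne
  obtain ⟨i, hiT, hiS⟩ := exists_of_ssubset (hST.ssubset_of_ne hne)
  exact absurd h (not_le.2 (sum_lt_sum_of_subset hST hiT hiS (hf i) fun j _ _ => (hf j).le))

/-- the point probability of `X = ∑ a i ξ i` is at most the maximum
point probability achievable when every coefficient is `1` or `-1`. -/
theorem stmt_0 (n : ℕ) (hn : 0 < n) (p : ℝ) (hp0 : 0 ≤ p) (hp1 : p ≤ 1)
    (a : Fin n → ℝ) (ha : ∀ i, a i ≠ 0) (x : ℝ) :
    ∃ ℓ : ℕ, ℓ ≤ n ∧ ∃ y : ℤ, -((n : ℤ) - (ℓ : ℤ)) ≤ y ∧ y ≤ (ℓ : ℤ) ∧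
      P n a p x ≤ D ℓ (n - ℓ) p y := by
  classical
  let q : Fin n → Prop := fun i => 0 < a i
  have hn' : Fintype.card {i // q i} + Fintype.card {i // ¬ q i} = n := by
    rw [← Fintype.card_sum, Fintype.card_congr (Equiv.sumCompl q), Fintype.card_fin]
  set ℓ := Fintype.card {i // q i} with hℓ
  have hm : Fintype.card {i // ¬ q i} = n - ℓ := by omega
  obtain ⟨y, hy, hmax⟩ := exists_max_image (Icc (-((n : ℤ) - ℓ)) (ℓ : ℤ)) (D ℓ (n - ℓ) p)
    ⟨0, by rw [mem_Icc]; omega⟩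
  rw [mem_Icc] at hy
  refine ⟨ℓ, by omega, y, hy.1, hy.2, ?_⟩
  rw [P_eq_sum_sum n a p x q]
  refine sum_antichain_le hp0 hp1
    (fun (U : Finset {i // q i}) (V : Finset {i // ¬ q i}) =>
      (∑ i ∈ U, a i) + ∑ i ∈ V, a i = x) ?_ (D_nonneg hp0 hp1 _ _ _) ?_
  · intro U V U' V' h h' hU hV
    have hpos : ∀ i : {i // q i}, 0 < a i := fun i => i.2
    have hneg : ∀ i : {i // ¬ q i}, 0 < -a i := fun i =>
      neg_pos.2 (lt_of_le_of_ne (not_lt.1 i.2) (ha i))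
    have h1 : ∑ i ∈ U, a i ≤ ∑ i ∈ U', a i :=
      sum_le_sum_of_subset_of_nonneg hU fun i _ _ => (hpos i).le
    have h2 : ∑ i ∈ V', -a i ≤ ∑ i ∈ V, -a i :=
      sum_le_sum_of_subset_of_nonneg hV fun i _ _ => (hneg i).le
    simp only [sum_neg_distrib] at h2
    refine ⟨eq_of_subset_of_sum_le hpos hU (by linarith),
      (eq_of_subset_of_sum_le hneg hV ?_).symm⟩
    simp only [sum_neg_distrib]
    linarith
  · intro k hk j hj
    rw [hm] at hj ⊢
    exact hmax _ (by rw [mem_Icc]; omega)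
end

section
/- Let n be a positive integer, let p be a real with 0 ≤ p ≤ 1, and let a_1, …, a_n be strictly positive reals. Then for every x ∈ ℝ, P(a; p; x) ≤ max_{0 ≤ k ≤ n} C(n,k) p^k (1−p)^{n−k}; that is, the point probability of X = Σ a_i ξ_i is at most the largest point probability of the binomial distribution Bin(n, p), which is achieved when a_1 = … = a_n = 1. -/
open Finset

/-- The sets over which a strictly positive family has a prescribed sum form an antichain. -/
theorem isAntichain_sum_eq {ι : Type*} {a : ι → ℝ} (ha : ∀ i, 0 < a i) (x : ℝ) :
    IsAntichain (· ⊆ ·) ({S : Finset ι | ∑ i ∈ S, a i = x} : Set (Finset ι)) := by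
  intro S hS T hT hne hST
  obtain ⟨i, hiT, hiS⟩ := Finset.exists_of_ssubset (hST.ssubset_of_ne hne)
  have h : ∑ i ∈ S, a i < ∑ i ∈ T, a i :=
    Finset.sum_lt_sum_of_subset hST hiT hiS (ha i) fun j _ _ => (ha j).le
  rw [Set.mem_ofPred_eq] at hS hT
  linarith

/-- A rank-dependent weight on an antichain is at most any upper bound for the total weights
of the levels. -/
theorem sum_weight_card_le_of_isAntichain {α : Type*} [Fintype α] {𝒜 : Finset (Finset α)}
    (h𝒜 : IsAntichain (· ⊆ ·) (𝒜 : Set (Finset α))) {w : ℕ → ℝ} {M : ℝ} (hM : 0 ≤ M)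
    (hw : ∀ k ≤ Fintype.card α, ((Fintype.card α).choose k : ℝ) * w k ≤ M) :
    ∑ S ∈ 𝒜, w S.card ≤ M := by
  calc ∑ S ∈ 𝒜, w S.card
      ≤ ∑ S ∈ 𝒜, M * ((Fintype.card α).choose S.card : ℝ)⁻¹ := by
        refine Finset.sum_le_sum fun S _ => ?_
        have hpos : (0 : ℝ) < (Fintype.card α).choose S.card := by
          exact_mod_cast Nat.choose_pos S.card_le_univ
        rw [← div_eq_mul_inv, le_div_iff₀ hpos, mul_comm]
        exact hw _ S.card_le_univ
    _ = M * ∑ S ∈ 𝒜, ((Fintype.card α).choose S.card : ℝ)⁻¹ := by rw [Finset.mul_sum]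
    _ ≤ M := mul_le_of_le_one_right hM
        (lubell_yamamoto_meshalkin_inequality_sum_inv_choose h𝒜)

/-- for strictly positive coefficients, the point probability is at most
the largest point probability of `Bin(n,p)`. -/
theorem stmt_1 (n : ℕ) (hn : 0 < n) (p : ℝ) (hp0 : 0 ≤ p) (hp1 : p ≤ 1)
    (a : Fin n → ℝ) (ha : ∀ i, 0 < a i) (x : ℝ) :
    ∃ k : ℕ, k ≤ n ∧ P n a p x ≤ (n.choose k : ℝ) * p ^ k * (1 - p) ^ (n - k) := by
  obtain ⟨k, hk, hmax⟩ := Finset.exists_max_image (Finset.range (n + 1))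
    (fun k => (n.choose k : ℝ) * p ^ k * (1 - p) ^ (n - k)) ⟨0, by simp⟩
  refine ⟨k, Finset.mem_range_succ_iff.1 hk, ?_⟩
  have hq : 0 ≤ 1 - p := sub_nonneg.2 hp1
  rw [P, ← Finset.sum_filter]
  refine sum_weight_card_le_of_isAntichain (w := fun k => p ^ k * (1 - p) ^ (n - k)) ?_
    (by positivity) fun j hj => ?_
  · simpa using isAntichain_sum_eq ha x
  · rw [Fintype.card_fin] at hj ⊢
    rw [← mul_assoc]
    exact hmax j (Finset.mem_range_succ_iff.2 hj)
end

section
/- Let ℓ be a positive integer, let a_1, …, a_ℓ be strictly positive reals, let k be an integer with 0 ≤ k < ℓ, and let r ∈ ℝ. Let 𝒯 be the collection of subsets S ⊆ {1,…,ℓ} with |S| = k+1 and Σ_{i∈S} a_i ≤ r, and let 𝒮 be the collection of subsets S ⊆ {1,…,ℓ} with |S| = k and Σ_{i∈S} a_i ≥ r. Then |𝒯|·C(ℓ,k) + |𝒮|·C(ℓ,k+1) ≤ C(ℓ,k)·C(ℓ,k+1), i.e. |𝒯|/C(ℓ,k+1) + |𝒮|/C(ℓ,k) ≤ 1. -/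
open Finset

/-- if `𝒯` is the family of `(k+1)`-subsets with sum at most `r` and `𝒮`
the family of `k`-subsets with sum at least `r`, then
`|𝒯|/C(ℓ,k+1) + |𝒮|/C(ℓ,k) ≤ 1`, cleared of denominators. -/
theorem stmt_2 (ℓ : ℕ) (hℓ : 0 < ℓ) (a : Fin ℓ → ℝ) (ha : ∀ i, 0 < a i)
    (k : ℕ) (hk : k < ℓ) (r : ℝ) :
    (Finset.univ.filter
        (fun S : Finset (Fin ℓ) => S.card = k + 1 ∧ (∑ i ∈ S, a i) ≤ r)).card * ℓ.choose k
      + (Finset.univ.filter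
        (fun S : Finset (Fin ℓ) => S.card = k ∧ r ≤ (∑ i ∈ S, a i))).card * ℓ.choose (k + 1)
      ≤ ℓ.choose k * ℓ.choose (k + 1) := by
  set 𝒯 := Finset.univ.filter
    (fun S : Finset (Fin ℓ) => S.card = k + 1 ∧ (∑ i ∈ S, a i) ≤ r)
  set 𝒮 := Finset.univ.filter
    (fun S : Finset (Fin ℓ) => S.card = k ∧ r ≤ (∑ i ∈ S, a i))
  have sized𝒯 : (𝒯 : Set (Finset (Fin ℓ))).Sized (k + 1) :=
    fun S hS => (mem_filter.1 (mem_coe.1 hS)).2.1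
  have sized𝒮 : (𝒮 : Set (Finset (Fin ℓ))).Sized k :=
    fun S hS => (mem_filter.1 (mem_coe.1 hS)).2.1
  have disj : Disjoint (shadow 𝒯) 𝒮 := by
    refine disjoint_left.2 fun S hS hS' => ?_
    obtain ⟨T, hT, i, hi, rfl⟩ := mem_shadow_iff.1 hS
    have hT := (mem_filter.1 hT).2.2
    have hS' := (mem_filter.1 hS').2.2
    have := add_sum_erase T a hi
    linarith [ha i]
  have card_le : #(shadow 𝒯) + #𝒮 ≤ ℓ.choose k := by
    rw [← card_union_of_disjoint disj]
    have sized : ((shadow 𝒯 ∪ 𝒮 : Finset _) : Set (Finset (Fin ℓ))).Sized k := by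
      rw [coe_union]
      exact Set.sized_union.2 ⟨sized𝒯.shadow, sized𝒮⟩
    simpa using sized.card_le
  have lym : #𝒯 * ℓ.choose k ≤ #(shadow 𝒯) * ℓ.choose (k + 1) := by
    have h := local_lubell_yamamoto_meshalkin_inequality_mul sized𝒯
    rw [Fintype.card_fin, show ℓ - (k + 1) + 1 = ℓ - k by omega] at h
    refine Nat.le_of_mul_le_mul_right ?_ (Nat.sub_pos_of_lt hk)
    calc #𝒯 * ℓ.choose k * (ℓ - k) = #𝒯 * (k + 1) * ℓ.choose (k + 1) := by
          rw [mul_assoc, ← Nat.choose_succ_right_eq]; ring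
      _ ≤ #(shadow 𝒯) * (ℓ - k) * ℓ.choose (k + 1) := Nat.mul_le_mul_right _ h
      _ = #(shadow 𝒯) * ℓ.choose (k + 1) * (ℓ - k) := by ring
  calc #𝒯 * ℓ.choose k + #𝒮 * ℓ.choose (k + 1)
      ≤ (#(shadow 𝒯) + #𝒮) * ℓ.choose (k + 1) := by rw [add_mul]; gcongr
    _ ≤ ℓ.choose k * ℓ.choose (k + 1) := Nat.mul_le_mul_right _ card_le
end

section
/- Fix a nonnegative integer i. Every admissible function γ : {0,…,i} × ℝ → ℝ is a finite convex combination of pure functions: there exist finitely many pure functions ζ_1, …, ζ_N : {0,…,i} × ℝ → ℝ and reals λ_1, …, λ_N ≥ 0 with λ_1 + … + λ_N = 1 such that γ = λ_1 ζ_1 + … + λ_N ζ_N. -/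
open Finset

/-- A function `γ : {0,…,i} × ℝ → ℝ` (encoded as `ℕ → ℝ → ℝ`, only values at
`k ≤ i` are relevant) is admissible if it has finite support, is nonnegative,
each row sums to 1, and satisfies the interleaving inequality (Property 3). -/
def Admissible (i : ℕ) (γ : ℕ → ℝ → ℝ) : Prop :=
  {pr : ℕ × ℝ | pr.1 ≤ i ∧ γ pr.1 pr.2 ≠ 0}.Finite ∧
  (∀ k, k ≤ i → ∀ r, 0 ≤ γ k r) ∧
  (∀ k, k ≤ i → ∑ᶠ r, γ k r = 1) ∧
  (∀ k, k < i → ∀ r : ℝ,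
    (∑ᶠ r' ∈ {r' : ℝ | r' ≤ r}, γ (k + 1) r') +
      (∑ᶠ r' ∈ {r' : ℝ | r ≤ r'}, γ k r') ≤ 1)

/-- A function `ζ : {0,…,i} × ℝ → ℝ` is pure if there are reals
`r_0 < r_1 < … < r_i` with `ζ k r = 1` if `r = r_k` and `0` otherwise. -/
def IsPure (i : ℕ) (ζ : ℕ → ℝ → ℝ) : Prop :=
  ∃ rs : ℕ → ℝ, (∀ k, k < i → rs k < rs (k + 1)) ∧
    ∀ k, k ≤ i → ∀ r, ζ k r = if r = rs k then 1 else 0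

/-- A nonnegative weight on a finite set of reals with total mass one has a quantile function:
`q t` is the unique point at which the cumulative sum passes the level `t`. -/
theorem exists_quantile (S : Finset ℝ) (p : ℝ → ℝ) (hp : ∀ r, 0 ≤ p r)
    (hsum : ∑ x ∈ S, p x = 1) :
    ∃ q : ℝ → ℝ, ∀ t ∈ Set.Ioc (0 : ℝ) 1, ∀ r,
      q t = r ↔ ∑ x ∈ S with x < r, p x < t ∧ t ≤ ∑ x ∈ S with x ≤ r, p x := by
  have hex : ∀ t ∈ Set.Ioc (0 : ℝ) 1, ∃ m,
      ∑ x ∈ S with x < m, p x < t ∧ t ≤ ∑ x ∈ S with x ≤ m, p x := by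
    rintro t ⟨ht0, ht1⟩
    have hS : S.Nonempty := by
      by_contra h
      simp [Finset.not_nonempty_iff_eq_empty.mp h] at hsum
    set A := S.filter fun m => t ≤ ∑ x ∈ S with x ≤ m, p x
    have hAne : A.Nonempty := by
      refine ⟨S.max' hS, Finset.mem_filter.mpr ⟨S.max'_mem hS, ?_⟩⟩
      rwa [Finset.filter_true_of_mem fun x hx => S.le_max' x hx, hsum]
    refine ⟨A.min' hAne, ?_, (Finset.mem_filter.mp (A.min'_mem hAne)).2⟩
    set m := A.min' hAne
    rcases (S.filter fun x => x < m).eq_empty_or_nonempty with h | h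
    · simpa [h] using ht0
    · set m' := (S.filter fun x => x < m).max' h
      obtain ⟨hmS, hlt⟩ := Finset.mem_filter.mp ((S.filter fun x => x < m).max'_mem h)
      have hnot : ¬ t ≤ ∑ x ∈ S with x ≤ m', p x := fun hle =>
        absurd (A.min'_le m' (Finset.mem_filter.mpr ⟨hmS, hle⟩)) (not_le.mpr hlt)
      refine lt_of_le_of_lt (Finset.sum_le_sum_of_subset_of_nonneg ?_ fun x _ _ => hp x)
        (not_le.mp hnot)
      intro x hx
      exact Finset.mem_filter.mpr ⟨(Finset.mem_filter.mp hx).1, Finset.le_max' _ x hx⟩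
  have hle : ∀ r s, r < s → ∑ x ∈ S with x ≤ r, p x ≤ ∑ x ∈ S with x < s, p x := by
    intro r s hrs
    refine Finset.sum_le_sum_of_subset_of_nonneg ?_ fun x _ _ => hp x
    exact Finset.monotone_filter_right S fun x _ hx => lt_of_le_of_lt hx hrs
  choose! q hq using hex
  refine ⟨q, fun t ht r => ⟨fun h => h ▸ hq t ht, fun h => ?_⟩⟩
  have hqt := hq t ht
  rcases lt_trichotomy (q t) r with hlt | heq | hlt
  · linarith [hle _ _ hlt, h.1, hqt.2]
  · exact heq
  · linarith [hle _ _ hlt, h.2, hqt.1]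

/-- The law of a finitely valued measurable map, as a sum over its values. -/
theorem sum_measureReal_fiber {α β : Type*} [MeasurableSpace α] [DecidableEq β]
    (μ : MeasureTheory.Measure α) [MeasureTheory.IsFiniteMeasure μ] (s : Set α) (f : α → β)
    (I : Finset β) (hI : ∀ t ∈ s, f t ∈ I) (hmeas : ∀ b ∈ I, MeasurableSet {t ∈ s | f t = b})
    (P : β → Prop) [DecidablePred P] :
    ∑ b ∈ I with P b, μ.real {t ∈ s | f t = b} = μ.real {t ∈ s | P (f t)} := by
  rw [← MeasureTheory.measureReal_biUnion_finset]
  · congr 1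
    ext t
    simp only [Set.mem_iUnion, Finset.mem_filter, Set.mem_ofPred_eq, exists_prop]
    constructor
    · rintro ⟨b, ⟨_, hb⟩, hts, rfl⟩
      exact ⟨hts, hb⟩
    · rintro ⟨hts, hP⟩
      exact ⟨f t, ⟨hI t hts, hP⟩, hts, rfl⟩
  · intro a _ b _ hab
    refine Set.disjoint_left.mpr ?_
    rintro t ⟨_, h⟩ ⟨_, h'⟩
    exact hab (h.symm.trans h')
  · exact fun b hb => hmeas b (Finset.mem_filter.mp hb).1

/-- An admissible function restricted to a common finite set carrying all the supports: the rows
are probability weights and the cumulative sums interleave. -/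
theorem Admissible.exists_finset {i : ℕ} {γ : ℕ → ℝ → ℝ} (hγ : Admissible i γ) :
    ∃ S : Finset ℝ, (∀ k ≤ i, ∀ r, r ∉ S → γ k r = 0) ∧ (∀ k ≤ i, ∑ x ∈ S, γ k x = 1) ∧
      ∀ k < i, ∀ r, ∑ x ∈ S with x ≤ r, γ (k + 1) x ≤ ∑ x ∈ S with x < r, γ k x := by
  obtain ⟨hfin, -, hsum, hint⟩ := hγ
  set S := (hfin.image Prod.snd).toFinset
  have hzero : ∀ k ≤ i, ∀ r, r ∉ S → γ k r = 0 := by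
    intro k hk r hr
    by_contra h
    exact hr ((hfin.image Prod.snd).mem_toFinset.mpr ⟨(k, r), ⟨hk, h⟩, rfl⟩)
  have hsumS : ∀ k ≤ i, ∑ x ∈ S, γ k x = 1 := by
    intro k hk
    rw [← hsum k hk, finsum_eq_sum_of_support_subset]
    intro r hr
    by_contra h
    exact hr (hzero k hk r h)
  have hmem : ∀ k ≤ i, ∀ (P : ℝ → Prop) [DecidablePred P],
      ∑ᶠ r ∈ {r | P r}, γ k r = ∑ x ∈ S with P x, γ k x := by
    intro k hk P _
    apply finsum_mem_eq_sum_of_inter_support_eq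
    ext r
    simp only [Set.mem_inter_iff, Set.mem_ofPred_eq, Function.mem_support, Finset.coe_filter]
    exact ⟨fun h => ⟨⟨by_contra fun hr => h.2 (hzero k hk r hr), h.1⟩, h.2⟩,
      fun h => ⟨h.1.2, h.2⟩⟩
  refine ⟨S, hzero, hsumS, fun k hk r => ?_⟩
  have h := hint k hk r
  rw [hmem (k + 1) hk (fun x => x ≤ r), hmem k hk.le (fun x => r ≤ x)] at h
  have hsplit := Finset.sum_filter_add_sum_filter_not S (fun x => x < r) (γ k)
  simp only [not_lt] at hsplit
  linarith [hsumS k hk.le]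

/-- every admissible function is a finite convex combination of pure
functions. -/
theorem stmt_3 (i : ℕ) (γ : ℕ → ℝ → ℝ) (hγ : Admissible i γ) :
    ∃ (N : ℕ) (ζ : Fin N → ℕ → ℝ → ℝ) (lam : Fin N → ℝ),
      (∀ j, IsPure i (ζ j)) ∧ (∀ j, 0 ≤ lam j) ∧ (∑ j, lam j = 1) ∧
      ∀ k, k ≤ i → ∀ r, γ k r = ∑ j, lam j * ζ j k r := by
  classical
  obtain ⟨S, hzero, hsum, hint⟩ := hγ.exists_finset
  have hnn := hγ.2.1
  have hq : ∀ k ≤ i, ∃ q : ℝ → ℝ, ∀ t ∈ Set.Ioc (0 : ℝ) 1, ∀ r,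
      q t = r ↔ ∑ x ∈ S with x < r, γ k x < t ∧ t ≤ ∑ x ∈ S with x ≤ r, γ k x :=
    fun k hk => exists_quantile S (γ k) (hnn k hk) (hsum k hk)
  choose! q hq using hq
  have hlow : ∀ k ≤ i, ∀ r, 0 ≤ ∑ x ∈ S with x < r, γ k x :=
    fun k hk r => Finset.sum_nonneg fun x _ => hnn k hk x
  have hhigh : ∀ k ≤ i, ∀ r, ∑ x ∈ S with x ≤ r, γ k x ≤ 1 := fun k hk r =>
    hsum k hk ▸ Finset.sum_le_sum_of_subset_of_nonneg (Finset.filter_subset _ _)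
      fun x _ _ => hnn k hk x
  have hjump : ∀ k ≤ i, ∀ r,
      ∑ x ∈ S with x ≤ r, γ k x - ∑ x ∈ S with x < r, γ k x = γ k r := by
    intro k hk r
    have hrow : ∑ x ∈ S with x = r, γ k x = γ k r := by
      rw [Finset.sum_filter, Finset.sum_ite_eq']
      split_ifs with h
      · rfl
      · exact (hzero k hk r h).symm
    rw [← hrow, sub_eq_iff_eq_add, ← Finset.sum_union, ← Finset.filter_or]
    · simp only [le_iff_eq_or_lt]
    · exact Finset.disjoint_filter.mpr fun x _ h h' => h'.ne h
  have hqS : ∀ k ≤ i, ∀ t ∈ Set.Ioc (0 : ℝ) 1, q k t ∈ S := by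
    intro k hk t ht
    by_contra h
    have := (hq k hk t ht _).mp rfl
    linarith [hjump k hk (q k t), hzero k hk _ h]
  have hqlt : ∀ k < i, ∀ t ∈ Set.Ioc (0 : ℝ) 1, q k t < q (k + 1) t := by
    intro k hk t ht
    by_contra! h
    have h₀ := (hq k hk.le t ht _).mp rfl
    have h₁ := (hq (k + 1) hk t ht _).mp rfl
    have hmono : ∑ x ∈ S with x < q (k + 1) t, γ k x ≤ ∑ x ∈ S with x < q k t, γ k x :=
      Finset.sum_le_sum_of_subset_of_nonneg
        (Finset.monotone_filter_right S fun x _ hx => lt_of_lt_of_le hx h)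
        fun x _ _ => hnn k hk.le x
    linarith [hint k hk (q (k + 1) t)]
  have hfiber : ∀ k ≤ i, ∀ r, {t ∈ Set.Ioc (0 : ℝ) 1 | q k t = r} =
      Set.Ioc (∑ x ∈ S with x < r, γ k x) (∑ x ∈ S with x ≤ r, γ k x) := by
    intro k hk r
    ext t
    constructor
    · rintro ⟨ht, h⟩
      exact (hq k hk t ht r).mp h
    · intro h
      have ht : t ∈ Set.Ioc (0 : ℝ) 1 :=
        ⟨(hlow k hk r).trans_lt h.1, h.2.trans (hhigh k hk r)⟩
      exact ⟨ht, (hq k hk t ht r).mpr h⟩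
  let Q : ℝ → Fin (i + 1) → ℝ := fun t k => q k t
  have hfin : (Q '' Set.Ioc (0 : ℝ) 1).Finite := by
    refine (Fintype.piFinset fun _ : Fin (i + 1) => S).finite_toSet.subset ?_
    rintro _ ⟨t, ht, rfl⟩
    exact Finset.mem_coe.mpr
      (Fintype.mem_piFinset.mpr fun k => hqS k (Nat.lt_succ_iff.mp k.2) t ht)
  set I := hfin.toFinset
  have hQI : ∀ t ∈ Set.Ioc (0 : ℝ) 1, Q t ∈ I :=
    fun t ht => hfin.mem_toFinset.mpr ⟨t, ht, rfl⟩
  let μ : MeasureTheory.Measure ℝ := MeasureTheory.volume.restrict (Set.Ioc (0 : ℝ) 1)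
  have hμ : ∀ s ⊆ Set.Ioc (0 : ℝ) 1, μ.real s = MeasureTheory.volume.real s := by
    intro s hs
    simp only [μ, MeasureTheory.measureReal_def]
    rw [MeasureTheory.Measure.restrict_eq_self _ hs]
  have hmeas : ∀ f ∈ I, MeasurableSet {t ∈ Set.Ioc (0 : ℝ) 1 | Q t = f} := by
    intro f _
    have : {t ∈ Set.Ioc (0 : ℝ) 1 | Q t = f} =
        ⋂ k : Fin (i + 1), {t ∈ Set.Ioc (0 : ℝ) 1 | q k t = f k} := by
      ext t
      simp [Q, funext_iff, forall_and]
    rw [this]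
    refine MeasurableSet.iInter fun k => ?_
    rw [hfiber k (Nat.lt_succ_iff.mp k.2)]
    exact measurableSet_Ioc
  let w : (Fin (i + 1) → ℝ) → ℝ := fun f => μ.real {t ∈ Set.Ioc (0 : ℝ) 1 | Q t = f}
  have hreindex : ∀ g : (Fin (i + 1) → ℝ) → ℝ,
      ∑ j : Fin I.card, g (I.equivFin.symm j) = ∑ f ∈ I, g f := by
    intro g
    rw [I.equivFin.symm.sum_comp fun f : I => g f, Finset.sum_coe_sort I g]
  have hval : ∀ k ≤ i, (Fin.ofNat (i + 1) k : ℕ) = k :=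
    fun k hk => Nat.mod_eq_of_lt (Nat.lt_succ_of_le hk)
  refine ⟨I.card, fun j k r => if r = (I.equivFin.symm j : Fin (i + 1) → ℝ) (Fin.ofNat _ k)
    then 1 else 0, fun j => w (I.equivFin.symm j), fun j => ?_,
    fun j => MeasureTheory.measureReal_nonneg, ?_, fun k hk r => ?_⟩
  · obtain ⟨t, ht, hQ⟩ := hfin.mem_toFinset.mp (I.equivFin.symm j).2
    refine ⟨fun k => (I.equivFin.symm j : Fin (i + 1) → ℝ) (Fin.ofNat _ k), fun k hk => ?_,
      fun k _ r => rfl⟩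
    simp only [← hQ, Q, hval k hk.le, hval (k + 1) hk]
    exact hqlt k hk t ht
  · rw [hreindex w]
    have h := sum_measureReal_fiber μ _ Q I hQI hmeas fun _ => True
    rw [hμ _ (Set.sep_subset _ _), Finset.filter_true, Set.sep_true,
      Real.volume_real_Ioc_of_le zero_le_one, sub_zero] at h
    exact h
  · rw [hreindex fun f => w f * if r = f (Fin.ofNat _ k) then 1 else 0]
    simp only [mul_ite, mul_one, mul_zero]
    rw [← Finset.sum_filter,
      sum_measureReal_fiber μ _ Q I hQI hmeas fun f => r = f (Fin.ofNat _ k),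
      hμ _ (Set.sep_subset _ _)]
    simp only [Q, hval k hk, eq_comm (a := r)]
    rw [hfiber k hk, Real.volume_real_Ioc_of_le, hjump k hk]
    linarith [hjump k hk r, hnn k hk r]
end

section
/- Let p be a real with 0 < p < 1, let ℓ, m be nonnegative integers, and let x ∈ ℝ. Define f(k) = C(ℓ,k) p^k (1−p)^{ℓ−k} for 0 ≤ k ≤ ℓ and g(j) = C(m,j) p^j (1−p)^{m−j} for 0 ≤ j ≤ m. For strictly increasing tuples r_0 < … < r_ℓ and s_0 < … < s_m of reals, define F(r,s) := Σ_{(k,j) : r_k = s_j + x} f(k) g(j). Suppose the pair (r, s) maximizes F over all pairs of strictly increasing tuples (i.e. F(r', s') ≤ F(r, s) for all strictly increasing r'_0 < … < r'_ℓ and s'_0 < … < s'_m). Then there do not exist indices k < ℓ and j with r_k < s_j + x < r_{k+1}, and there do not exist indices j < m and k with s_j + x < r_k < s_{j+1} + x. -/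
open Finset

/-- The matched-pair sum `F(r,s) = Σ_{(k,j) : r_k = s_j + x} f(k) g(j)` with
`f(k) = C(ℓ,k) p^k (1-p)^(ℓ-k)` and `g(j) = C(m,j) p^j (1-p)^(m-j)`. -/
noncomputable def F (ℓ m : ℕ) (p x : ℝ) (r s : ℕ → ℝ) : ℝ :=
  ∑ k ∈ Finset.range (ℓ + 1), ∑ j ∈ Finset.range (m + 1),
    if r k = s j + x then
      ((ℓ.choose k : ℝ) * p ^ k * (1 - p) ^ (ℓ - k)) *
        ((m.choose j : ℝ) * p ^ j * (1 - p) ^ (m - j))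
    else 0

/-- The binomial weight `C(n,k) p^k (1-p)^(n-k)`. -/
noncomputable def binomialWeight (n : ℕ) (p : ℝ) (k : ℕ) : ℝ :=
  (n.choose k : ℝ) * p ^ k * (1 - p) ^ (n - k)

theorem binomialWeight_pos {n k : ℕ} {p : ℝ} (hp0 : 0 < p) (hp1 : p < 1) (hk : k ≤ n) :
    0 < binomialWeight n p k := by
  have h1 : 0 < 1 - p := by linarith
  have h2 : (0 : ℝ) < n.choose k := by exact_mod_cast Nat.choose_pos hk
  unfold binomialWeight
  positivity

theorem binomialWeight_nonneg {p : ℝ} (hp0 : 0 < p) (hp1 : p < 1) (n k : ℕ) :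
    0 ≤ binomialWeight n p k := by
  have h1 : 0 < 1 - p := by linarith
  unfold binomialWeight
  positivity

theorem binomialWeight_succ_mul {n k : ℕ} (p : ℝ) (hk : k < n) :
    binomialWeight n p (k + 1) * ((k + 1) * (1 - p)) =
      binomialWeight n p k * ((n - k) * p) := by
  obtain ⟨d, rfl⟩ := Nat.exists_eq_add_of_lt hk
  have h := Nat.choose_succ_right_eq (k + d + 1) k
  rw [show k + d + 1 - k = d + 1 by omega] at h
  have h' : ((k + d + 1).choose (k + 1) : ℝ) * (k + 1) = (k + d + 1).choose k * (d + 1) := by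
    exact_mod_cast h
  unfold binomialWeight
  rw [show k + d + 1 - (k + 1) = d by omega, show k + d + 1 - k = d + 1 by omega]
  push_cast
  linear_combination p ^ (k + 1) * (1 - p) ^ (d + 1) * h'

theorem binomialWeight_lt_succ {n k : ℕ} {p : ℝ} (hp0 : 0 < p) (hp1 : p < 1) (hk : k < n)
    (h : (k : ℝ) + 1 < (n + 1) * p) : binomialWeight n p k < binomialWeight n p (k + 1) := by
  have hrec := binomialWeight_succ_mul p hk
  have hpos := binomialWeight_pos hp0 hp1 hk.le
  have hc : 0 < ((k : ℝ) + 1) * (1 - p) := mul_pos (by positivity) (by linarith)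
  refine lt_of_mul_lt_mul_right ?_ hc.le
  rw [hrec]
  exact mul_lt_mul_of_pos_left (by linarith) hpos

theorem binomialWeight_succ_lt {n k : ℕ} {p : ℝ} (hp0 : 0 < p) (hp1 : p < 1) (hk : k < n)
    (h : (n + 1) * p < (k : ℝ) + 1) : binomialWeight n p (k + 1) < binomialWeight n p k := by
  have hrec := binomialWeight_succ_mul p hk
  have hpos := binomialWeight_pos hp0 hp1 hk.le
  have hc : 0 < ((k : ℝ) + 1) * (1 - p) := mul_pos (by positivity) (by linarith)
  refine lt_of_mul_lt_mul_right ?_ hc.le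
  rw [hrec]
  exact mul_lt_mul_of_pos_left (by linarith) hpos

theorem lt_of_lt_succ_of_lt_of_le {n : ℕ} {u : ℕ → ℝ} (hu : ∀ k, k < n → u k < u (k + 1))
    {i j : ℕ} (hij : i < j) (hj : j ≤ n) : u i < u j := by
  induction j, hij using Nat.le_induction with
  | base => exact hu i hj
  | succ j hij ih => exact (ih (by omega)).trans (hu j hj)

theorem le_of_lt_succ_of_le_of_le {n : ℕ} {u : ℕ → ℝ} (hu : ∀ k, k < n → u k < u (k + 1))
    {i j : ℕ} (hij : i ≤ j) (hj : j ≤ n) : u i ≤ u j := by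
  rcases hij.eq_or_lt with rfl | h
  · exact le_rfl
  · exact (lt_of_lt_succ_of_lt_of_le hu h hj).le

/-- The total binomial weight of the points of `u` of index at most `n` located at `t`. -/
noncomputable def weightAt (n : ℕ) (p : ℝ) (u : ℕ → ℝ) (t : ℝ) : ℝ :=
  ∑ k ∈ range (n + 1), if u k = t then binomialWeight n p k else 0

theorem weightAt_nonneg {p : ℝ} (hp0 : 0 < p) (hp1 : p < 1) (n : ℕ) (u : ℕ → ℝ) (t : ℝ) :
    0 ≤ weightAt n p u t := by
  refine sum_nonneg fun k _ => ?_
  split_ifs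
  · exact binomialWeight_nonneg hp0 hp1 n k
  · exact le_rfl

theorem weightAt_pos {n k : ℕ} {p : ℝ} (hp0 : 0 < p) (hp1 : p < 1) (hk : k ≤ n)
    {u : ℕ → ℝ} {t : ℝ} (h : u k = t) : 0 < weightAt n p u t := by
  refine sum_pos' (fun i _ => ?_) ⟨k, mem_range.2 (by omega), ?_⟩
  · split_ifs
    · exact binomialWeight_nonneg hp0 hp1 n i
    · exact le_rfl
  · rw [if_pos h]
    exact binomialWeight_pos hp0 hp1 hk

theorem weightAt_eq_zero {n : ℕ} {p : ℝ} {u : ℕ → ℝ} {t : ℝ} (h : ∀ k ≤ n, u k ≠ t) :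
    weightAt n p u t = 0 :=
  sum_eq_zero fun k hk => if_neg (h k (by have := mem_range.1 hk; omega))

theorem F_comm (ℓ m : ℕ) (p x : ℝ) (r s : ℕ → ℝ) : F ℓ m p x r s = F m ℓ p (-x) s r := by
  unfold F
  rw [sum_comm]
  refine sum_congr rfl fun j _ => sum_congr rfl fun k _ => ?_
  have : r k = s j + x ↔ s j = r k + -x := by constructor <;> intro h <;> linarith
  simp only [this, mul_comm]

theorem F_eq_sum_weightAt (ℓ m : ℕ) (p x : ℝ) (r s : ℕ → ℝ) :
    F ℓ m p x r s =
      ∑ j ∈ range (m + 1), binomialWeight m p j * weightAt ℓ p r (s j + x) := by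
  unfold F weightAt
  rw [sum_comm]
  refine sum_congr rfl fun j _ => ?_
  rw [mul_sum]
  refine sum_congr rfl fun k _ => ?_
  split_ifs
  · unfold binomialWeight
    ring
  · simp

/-- Moving an unmatched point of `r` onto a point of `s + x` increases `F`. -/
theorem F_lt_F_update {ℓ m k j : ℕ} {p x : ℝ} {r s : ℕ → ℝ} (hp0 : 0 < p) (hp1 : p < 1)
    (hk : k ≤ ℓ) (hj : j ≤ m) (hun : ∀ i ≤ m, r k ≠ s i + x) :
    F ℓ m p x r s < F ℓ m p x (Function.update r k (s j + x)) s := by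
  rw [F_comm, F_comm ℓ, F_eq_sum_weightAt, F_eq_sum_weightAt]
  refine sum_lt_sum (fun i _ => ?_) ⟨k, mem_range.2 (by omega), ?_⟩
  · rcases eq_or_ne i k with rfl | hik
    · rw [weightAt_eq_zero (t := r i + -x) fun a ha h => hun a ha (by linarith), mul_zero]
      exact mul_nonneg (binomialWeight_nonneg hp0 hp1 _ _) (weightAt_nonneg hp0 hp1 _ _ _)
    · rw [Function.update_of_ne hik]
  · rw [weightAt_eq_zero (t := r k + -x) fun a ha h => hun a ha (by linarith), mul_zero]
    refine mul_pos (binomialWeight_pos hp0 hp1 hk) (weightAt_pos hp0 hp1 hj ?_)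
    simp

theorem not_unmatched_of_maximal {ℓ m k j : ℕ} {p x : ℝ} {r s : ℕ → ℝ} (hp0 : 0 < p) (hp1 : p < 1)
    (hr : ∀ k, k < ℓ → r k < r (k + 1)) (hs : ∀ j, j < m → s j < s (j + 1))
    (hmax : ∀ r' s' : ℕ → ℝ, (∀ k, k < ℓ → r' k < r' (k + 1)) →
      (∀ j, j < m → s' j < s' (j + 1)) → F ℓ m p x r' s' ≤ F ℓ m p x r s)
    (hk : k ≤ ℓ) (hj : j ≤ m)
    (hleft : ∀ i, i + 1 = k → r i < s j + x) (hright : k < ℓ → s j + x < r (k + 1)) :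
    ∃ i ≤ m, r k = s i + x := by
  by_contra! hun
  refine (F_lt_F_update hp0 hp1 hk hj hun).not_ge (hmax _ s (fun i hi => ?_) hs)
  rcases eq_or_ne i k with rfl | h1
  · rw [Function.update_self, Function.update_of_ne (by omega)]
    exact hright hi
  · rw [Function.update_of_ne h1]
    rcases eq_or_ne (i + 1) k with h2 | h2
    · rw [h2, Function.update_self]
      exact hleft i h2
    · rw [Function.update_of_ne h2]
      exact hr i hi

/-- If the point of index `a + 1` has weight zero, moving the indices up to `a` one step up
increases a sum with weights increasing up to `a + 1`. -/
theorem sum_lt_sum_shift_up {a d : ℕ} {g W : ℕ → ℝ} {W' : ℕ → ℝ} (hg0 : 0 ≤ g 0 * W' 0)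
    (hg : ∀ i ≤ a, g i < g (i + 1)) (hW : ∀ i, 0 ≤ W i) (ha : 0 < W a) (ha1 : W (a + 1) = 0)
    (hlow : ∀ i ≤ a, W' (i + 1) = W i) (hhigh : ∀ i, W' (a + 2 + i) = W (a + 2 + i)) :
    ∑ i ∈ range (a + 2 + d), g i * W i < ∑ i ∈ range (a + 2 + d), g i * W' i := by
  rw [sum_range_add _ (a + 2), sum_range_add _ (a + 2), sum_range_succ _ (a + 1),
    sum_range_succ' _ (a + 1), ha1]
  have h1 : ∑ i ∈ range (a + 1), g i * W i < ∑ i ∈ range (a + 1), g (i + 1) * W' (i + 1) := by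
    refine sum_lt_sum (fun i hi => ?_) ⟨a, mem_range.2 (by omega), ?_⟩
    · have hi' : i ≤ a := by have := mem_range.1 hi; omega
      rw [hlow i hi']
      exact mul_le_mul_of_nonneg_right (hg i hi').le (hW i)
    · rw [hlow a le_rfl]
      exact mul_lt_mul_of_pos_right (hg a le_rfl) ha
  simp only [hhigh]
  linarith

/-- If the point of index `c` has weight zero, moving the indices from `c + 1` on one step down
increases a sum with weights decreasing from `c` on. -/
theorem sum_lt_sum_shift_down {c e : ℕ} {g W : ℕ → ℝ} {W' : ℕ → ℝ}
    (hge : 0 ≤ g (c + (e + 1)) * W' (c + (e + 1)))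
    (hg : ∀ i ≤ e, g (c + (i + 1)) < g (c + i)) (hW : ∀ i, 0 ≤ W i) (hc : W c = 0)
    (hc1 : 0 < W (c + 1)) (hlow : ∀ i < c, W' i = W i)
    (hhigh : ∀ i ≤ e, W' (c + i) = W (c + (i + 1))) :
    ∑ i ∈ range (c + (e + 2)), g i * W i < ∑ i ∈ range (c + (e + 2)), g i * W' i := by
  rw [sum_range_add _ c, sum_range_add _ c, sum_range_succ' _ (e + 1), sum_range_succ _ (e + 1),
    add_zero, hc]
  have h0 : ∑ i ∈ range c, g i * W' i = ∑ i ∈ range c, g i * W i :=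
    sum_congr rfl fun i hi => by rw [hlow i (mem_range.1 hi)]
  have h1 : ∑ i ∈ range (e + 1), g (c + (i + 1)) * W (c + (i + 1)) <
      ∑ i ∈ range (e + 1), g (c + i) * W' (c + i) := by
    refine sum_lt_sum (fun i hi => ?_) ⟨0, mem_range.2 (by omega), ?_⟩
    · have hi' : i ≤ e := by have := mem_range.1 hi; omega
      rw [hhigh i hi']
      exact mul_le_mul_of_nonneg_right (hg i hi').le (hW _)
    · rw [hhigh 0 (Nat.zero_le _)]
      exact mul_lt_mul_of_pos_right (hg 0 (Nat.zero_le _)) hc1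
  linarith

theorem not_interleave_of_maximal {ℓ m : ℕ} {p x : ℝ} {r s : ℕ → ℝ} (hp0 : 0 < p) (hp1 : p < 1)
    (hr : ∀ k, k < ℓ → r k < r (k + 1)) (hs : ∀ j, j < m → s j < s (j + 1))
    (hmax : ∀ r' s' : ℕ → ℝ, (∀ k, k < ℓ → r' k < r' (k + 1)) →
      (∀ j, j < m → s' j < s' (j + 1)) → F ℓ m p x r' s' ≤ F ℓ m p x r s) :
    ¬ ∃ k j : ℕ, k < ℓ ∧ j ≤ m ∧ r k < s j + x ∧ s j + x < r (k + 1) := by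
  rintro ⟨k, j, hk, hj, hlo, hhi⟩
  obtain ⟨a, ham, ha⟩ := not_unmatched_of_maximal hp0 hp1 hr hs hmax hk.le hj
    (fun i hi => by subst hi; exact (hr i (by omega)).trans hlo) (fun _ => hhi)
  obtain ⟨b, hbm, hb⟩ := not_unmatched_of_maximal hp0 hp1 hr hs hmax (k := k + 1) hk hj
    (fun i hi => by obtain rfl : i = k := by omega
                    exact hlo)
    (fun h => hhi.trans (hr _ h))
  have haj : a < j := by
    by_contra! h
    linarith [le_of_lt_succ_of_le_of_le hs h ham]
  have hjb : j < b := by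
    by_contra! h
    linarith [le_of_lt_succ_of_le_of_le hs h hj]
  have hzero : ∀ i, a < i → i < b → weightAt ℓ p r (s i + x) = 0 := by
    intro i hai hib
    refine weightAt_eq_zero fun q hq h => ?_
    have h1 := lt_of_lt_succ_of_lt_of_le hs hai (by omega)
    have h2 := lt_of_lt_succ_of_lt_of_le hs hib hbm
    rcases Nat.lt_or_ge k q with hkq | hkq
    · linarith [le_of_lt_succ_of_le_of_le hr hkq hq]
    · linarith [le_of_lt_succ_of_le_of_le hr hkq hk.le]
  have hWa : 0 < weightAt ℓ p r (s a + x) := weightAt_pos hp0 hp1 hk.le ha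
  have hWb : 0 < weightAt ℓ p r (s b + x) := weightAt_pos hp0 hp1 hk hb
  by_cases hmode : (a : ℝ) + 1 < (m + 1) * p
  · set s' : ℕ → ℝ := fun i => if i = 0 then s 0 - 1 else if i ≤ a + 1 then s (i - 1) else s i
      with hs'
    have hmono : ∀ i, i < m → s' i < s' (i + 1) := by
      intro i hi
      simp only [hs', Nat.add_sub_cancel]
      rw [if_neg (Nat.succ_ne_zero i)]
      rcases Nat.eq_zero_or_pos i with rfl | h1
      · rw [if_pos rfl, if_pos (by omega)]
        linarith
      rw [if_neg h1.ne']
      split_ifs <;> first | omega | exact lt_of_lt_succ_of_lt_of_le hs (by omega) (by omega)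
    refine (hmax r s' hr hmono).not_gt ?_
    rw [F_eq_sum_weightAt, F_eq_sum_weightAt]
    obtain ⟨d, hd⟩ : ∃ d, m + 1 = a + 2 + d := ⟨m - a - 1, by omega⟩
    rw [hd]
    refine sum_lt_sum_shift_up (W := fun i => weightAt ℓ p r (s i + x))
      (W' := fun i => weightAt ℓ p r (s' i + x)) ?_ (fun i hi => ?_)
      (fun i => weightAt_nonneg hp0 hp1 _ _ _) hWa (hzero _ (by omega) (by omega))
      (fun i hi => ?_) (fun i => ?_)
    · exact mul_nonneg (binomialWeight_nonneg hp0 hp1 _ _) (weightAt_nonneg hp0 hp1 _ _ _)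
    · refine binomialWeight_lt_succ hp0 hp1 (by omega) (lt_of_le_of_lt ?_ hmode)
      gcongr
    · have : s' (i + 1) = s i := by simp [hs', hi]
      simp only [this]
    · have : s' (a + 2 + i) = s (a + 2 + i) := by
        simp only [hs']
        rw [if_neg (by omega), if_neg (by omega)]
      simp only [this]
  · push Not at hmode
    obtain ⟨c, rfl⟩ : ∃ c, b = c + 1 := ⟨b - 1, by omega⟩
    obtain ⟨e, rfl⟩ : ∃ e, m = c + (e + 1) := ⟨m - c - 1, by omega⟩
    set s' : ℕ → ℝ := fun i =>
      if i < c then s i else if i < c + (e + 1) then s (i + 1) else s (c + (e + 1)) + 1 with hs'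
    have hmono : ∀ i, i < c + (e + 1) → s' i < s' (i + 1) := by
      intro i hi
      simp only [hs']
      split_ifs <;> first | omega | exact lt_of_lt_succ_of_lt_of_le hs (by omega) (by omega) | skip
      · have : i + 1 = c + (e + 1) := by omega
        rw [this]; linarith
    refine (hmax r s' hr hmono).not_gt ?_
    rw [F_eq_sum_weightAt, F_eq_sum_weightAt]
    refine sum_lt_sum_shift_down (W := fun i => weightAt ℓ p r (s i + x))
      (W' := fun i => weightAt ℓ p r (s' i + x)) ?_ (fun i hi => ?_)
      (fun i => weightAt_nonneg hp0 hp1 _ _ _) (hzero _ (by omega) (by omega)) hWb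
      (fun i hi => ?_) (fun i hi => ?_)
    · exact mul_nonneg (binomialWeight_nonneg hp0 hp1 _ _) (weightAt_nonneg hp0 hp1 _ _ _)
    · refine binomialWeight_succ_lt hp0 hp1 (k := c + i) (by omega) (lt_of_le_of_lt hmode ?_)
      have : a < c + i := by omega
      gcongr
    · have : s' i = s i := by simp [hs', hi]
      simp only [this]
    · have : s' (c + i) = s (c + (i + 1)) := by
        simp only [hs']
        rw [if_neg (by omega), if_pos (by omega), add_assoc]
      simp only [this]

/-- if `(r, s)` maximizes `F` over pairs of strictly increasing tuples,
then the values `r_k` and `s_j + x` never strictly interleave. -/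
theorem stmt_4 (p : ℝ) (hp0 : 0 < p) (hp1 : p < 1) (ℓ m : ℕ) (x : ℝ)
    (r s : ℕ → ℝ)
    (hr : ∀ k, k < ℓ → r k < r (k + 1)) (hs : ∀ j, j < m → s j < s (j + 1))
    (hmax : ∀ r' s' : ℕ → ℝ, (∀ k, k < ℓ → r' k < r' (k + 1)) →
      (∀ j, j < m → s' j < s' (j + 1)) → F ℓ m p x r' s' ≤ F ℓ m p x r s) :
    (¬ ∃ k j : ℕ, k < ℓ ∧ j ≤ m ∧ r k < s j + x ∧ s j + x < r (k + 1)) ∧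
    (¬ ∃ j k : ℕ, j < m ∧ k ≤ ℓ ∧ s j + x < r k ∧ r k < s (j + 1) + x) := by
  refine ⟨not_interleave_of_maximal hp0 hp1 hr hs hmax, ?_⟩
  rintro ⟨j, k, hj, hk, h1, h2⟩
  refine not_interleave_of_maximal (x := -x) hp0 hp1 hs hr (fun s' r' hs' hr' => ?_)
    ⟨j, k, hj, hk, by linarith, by linarith⟩
  rw [← F_comm, ← F_comm]
  exact hmax r' s' hr' hs'
end

section
/- Let p be a real with 0 < p < 1, let ℓ, m be nonnegative integers, and let x ∈ ℝ. Define f(k) = C(ℓ,k) p^k (1−p)^{ℓ−k} for 0 ≤ k ≤ ℓ and g(j) = C(m,j) p^j (1−p)^{m−j} for 0 ≤ j ≤ m. For strictly increasing tuples r_0 < … < r_ℓ and s_0 < … < s_m of reals, define F(r,s) := Σ_{(k,j) : r_k = s_j + x} f(k) g(j). Suppose the pair (r, s) maximizes F over all pairs of strictly increasing tuples, and suppose r_k = s_j + x for some indices 0 ≤ k ≤ ℓ and 0 ≤ j ≤ m. Then for all indices 0 ≤ k' ≤ ℓ and 0 ≤ j' ≤ m with k' − j' = k − j, one also has r_{k'}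 = s_{j'} + x. -/
open Finset

/-- A weight on `{0, …, n}` that is positive and strictly unimodal: around every interior point `c`,
it strictly increases up to `c` or strictly decreases from `c` on. -/
structure StrictlyUnimodal (n : ℕ) (f : ℕ → ℝ) : Prop where
  pos : ∀ i ≤ n, 0 < f i
  mono_or_anti : ∀ c, 0 < c → c < n →
    (∀ i < c, f i < f (i + 1)) ∨ (∀ i, c ≤ i → i < n → f (i + 1) < f i)

/-- `t 0 < t 1 < ⋯ < t n`. -/
def IncreasingUpTo (n : ℕ) (t : ℕ → ℝ) : Prop := ∀ i < n, t i < t (i + 1)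

/-- The total weight `∑ f k * g j` of the pairs `(k, j)` with `r k = s j`. -/
noncomputable def matchedWeight (ℓ m : ℕ) (f g r s : ℕ → ℝ) : ℝ :=
  ∑ k ∈ range (ℓ + 1), ∑ j ∈ range (m + 1), if r k = s j then f k * g j else 0

/-- The increasing tuples `r`, `s` maximize `matchedWeight`. -/
structure IsOptimal (ℓ m : ℕ) (f g r s : ℕ → ℝ) : Prop where
  left : IncreasingUpTo ℓ r
  right : IncreasingUpTo m s
  max : ∀ r' s', IncreasingUpTo ℓ r' → IncreasingUpTo m s' →
    matchedWeight ℓ m f g r' s' ≤ matchedWeight ℓ m f g r s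

lemma StrictlyUnimodal.reflect {n : ℕ} {f : ℕ → ℝ} (hf : StrictlyUnimodal n f) :
    StrictlyUnimodal n (fun i ↦ f (n - i)) where
  pos i _ := hf.pos _ (by omega)
  mono_or_anti c hc hcn := by
    rcases hf.mono_or_anti (n - c) (by omega) (by omega) with h | h
    · right
      intro i hi hin
      have := h (n - (i + 1)) (by omega)
      rwa [show n - (i + 1) + 1 = n - i by omega] at this
    · left
      intro i hi
      have := h (n - (i + 1)) (by omega) (by omega)
      rwa [show n - (i + 1) + 1 = n - i by omega] at this

lemma strictlyUnimodal_binomial (n : ℕ) {p : ℝ} (hp0 : 0 < p) (hp1 : p < 1) :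
    StrictlyUnimodal n (fun i ↦ (n.choose i : ℝ) * p ^ i * (1 - p) ^ (n - i)) := by
  have hq : 0 < 1 - p := sub_pos.2 hp1
  have pos : ∀ i ≤ n, 0 < (n.choose i : ℝ) * p ^ i * (1 - p) ^ (n - i) := fun i hi ↦ by
    have : 0 < n.choose i := Nat.choose_pos hi
    positivity
  have rec_eq : ∀ i < n, (n.choose (i + 1) : ℝ) * p ^ (i + 1) * (1 - p) ^ (n - (i + 1)) *
      ((i + 1) * (1 - p)) = (n.choose i : ℝ) * p ^ i * (1 - p) ^ (n - i) * ((n - i) * p) := by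
    intro i hi
    have h : (n.choose (i + 1) : ℝ) * (i + 1) = n.choose i * (n - i) := by
      have := Nat.choose_succ_right_eq n i
      rw [← Nat.cast_sub hi.le]
      exact_mod_cast this
    rw [show n - i = n - (i + 1) + 1 by omega, pow_succ, pow_succ]
    linear_combination p ^ i * p * (1 - p) ^ (n - (i + 1)) * (1 - p) * h
  refine ⟨pos, fun c hc hcn ↦ ?_⟩
  rcases lt_or_ge (c : ℝ) ((n + 1) * p) with h | h
  · left
    intro i hi
    have hic : (i : ℝ) + 1 ≤ c := by exact_mod_cast hi
    have h1 : 0 < ((i : ℝ) + 1) * (1 - p) := by positivity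
    refine lt_of_mul_lt_mul_right ?_ h1.le
    rw [rec_eq i (by omega)]
    exact mul_lt_mul_of_pos_left (by linarith) (pos i (by omega))
  · right
    intro i hi hin
    have hic : (c : ℝ) ≤ i := by exact_mod_cast hi
    have h1 : 0 < ((i : ℝ) + 1) * (1 - p) := by positivity
    refine lt_of_mul_lt_mul_right ?_ h1.le
    rw [rec_eq i hin]
    exact mul_lt_mul_of_pos_left (by linarith) (pos i hin.le)

lemma IncreasingUpTo.lt {n : ℕ} {t : ℕ → ℝ} (ht : IncreasingUpTo n t) {a b : ℕ} (hab : a < b)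
    (hb : b ≤ n) : t a < t b := by
  induction b, hab using Nat.le_induction with
  | base => exact ht a hb
  | succ b hab ih => exact (ih (by omega)).trans (ht b hb)

lemma IncreasingUpTo.lt_iff {n : ℕ} {t : ℕ → ℝ} (ht : IncreasingUpTo n t) {a b : ℕ} (ha : a ≤ n)
    (hb : b ≤ n) : t a < t b ↔ a < b := by
  refine ⟨fun h ↦ ?_, fun h ↦ ht.lt h hb⟩
  by_contra! hba
  rcases hba.eq_or_lt with rfl | hba
  · exact lt_irrefl _ h
  · exact lt_asymm h (ht.lt hba ha)

lemma IncreasingUpTo.reflect {n : ℕ} {t : ℕ → ℝ} (ht : IncreasingUpTo n t) :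
    IncreasingUpTo n (fun i ↦ -t (n - i)) := fun i hi ↦
  neg_lt_neg (ht.lt (by omega) (by omega))

/-- Continuing an increasing sequence beyond `a` in steps of `1`. -/
lemma IncreasingUpTo.extend {n : ℕ} {t : ℕ → ℝ} (ht : IncreasingUpTo n t) (a : ℕ) :
    IncreasingUpTo n (fun i ↦ if i ≤ a then t i else t a + ((i : ℝ) - a)) := by
  intro i hi
  dsimp only
  split_ifs with h1 h2 h2
  · exact ht i hi
  · obtain rfl : i = a := by omega
    push_cast
    linarith
  · omega
  · push_cast
    linarith

lemma matchedWeight_swap (ℓ m : ℕ) (f g r s : ℕ → ℝ) :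
    matchedWeight m ℓ g f s r = matchedWeight ℓ m f g r s := by
  unfold matchedWeight
  rw [sum_comm]
  simp only [eq_comm, mul_comm]

lemma IsOptimal.swap {ℓ m : ℕ} {f g r s : ℕ → ℝ} (h : IsOptimal ℓ m f g r s) :
    IsOptimal m ℓ g f s r := by
  refine ⟨h.right, h.left, fun r' s' hr' hs' ↦ ?_⟩
  rw [matchedWeight_swap ℓ m f g s' r', matchedWeight_swap ℓ m f g r s]
  exact h.max s' r' hs' hr'

lemma matchedWeight_reflect (ℓ m : ℕ) (f g r s : ℕ → ℝ) :
    matchedWeight ℓ m (fun i ↦ f (ℓ - i)) (fun i ↦ g (m - i)) r s =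
      matchedWeight ℓ m f g (fun i ↦ -r (ℓ - i)) (fun i ↦ -s (m - i)) := by
  unfold matchedWeight
  rw [← sum_flip]
  refine sum_congr rfl fun k hk ↦ ?_
  rw [← sum_flip]
  refine sum_congr rfl fun j hj ↦ ?_
  rw [mem_range] at hk hj
  simp only [neg_inj, show ℓ - (ℓ - k) = k by omega, show m - (m - j) = j by omega]

lemma IsOptimal.reflect {ℓ m : ℕ} {f g r s : ℕ → ℝ} (h : IsOptimal ℓ m f g r s) :
    IsOptimal ℓ m (fun i ↦ f (ℓ - i)) (fun i ↦ g (m - i)) (fun i ↦ -r (ℓ - i))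
      (fun i ↦ -s (m - i)) := by
  refine ⟨h.left.reflect, h.right.reflect, fun r' s' hr' hs' ↦ ?_⟩
  have key : matchedWeight ℓ m f g (fun i ↦ - -r (ℓ - (ℓ - i))) (fun i ↦ - -s (m - (m - i))) =
      matchedWeight ℓ m f g r s := by
    refine sum_congr rfl fun k hk ↦ sum_congr rfl fun j hj ↦ ?_
    rw [mem_range] at hk hj
    simp only [neg_neg, show ℓ - (ℓ - k) = k by omega, show m - (m - j) = j by omega]
  rw [matchedWeight_reflect, matchedWeight_reflect]
  exact (h.max _ _ hr'.reflect hs'.reflect).trans key.ge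

lemma sum_range_succ_eq_add_sum_skip (T : ℕ → ℝ) {c m : ℕ} (hc : c ≤ m) :
    ∑ i ∈ range (m + 1), T i = T c + ∑ i ∈ range m, if i < c then T i else T (i + 1) := by
  induction m, hc using Nat.le_induction with
  | base =>
    rw [sum_range_succ, add_comm]
    congr 1
    exact sum_congr rfl fun i hi ↦ (if_pos (mem_range.1 hi)).symm
  | succ m hc ih =>
    rw [sum_range_succ, ih, sum_range_succ _ m, if_neg (by omega), add_assoc]

/-- If `φ` vanishes at an interior point `s c` of the sequence, moving the part of the sequence on
one side of `c` by one index towards `c` increases the weighted sum. -/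
lemma exists_sum_lt_of_gap {m : ℕ} {g s φ : ℕ → ℝ} {ψ : ℝ → ℝ} (hg : StrictlyUnimodal m g)
    (hs : IncreasingUpTo m s) (hφ : ∀ i, φ i = ψ (s i)) (hψ : ∀ y, 0 ≤ ψ y) {a b c : ℕ}
    (hac : a < c) (hcb : c < b) (hb : b ≤ m) (ha0 : 0 < φ a) (hc0 : φ c = 0) (hb0 : 0 < φ b) :
    ∃ s', IncreasingUpTo m s' ∧
      ∑ j ∈ range (m + 1), g j * φ j < ∑ j ∈ range (m + 1), g j * ψ (s' j) := by
  rw [sum_range_succ_eq_add_sum_skip _ (show c ≤ m by omega), hc0, mul_zero, zero_add]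
  rcases hg.mono_or_anti c (by omega) (by omega) with h | h
  · refine ⟨fun i ↦ if i = 0 then s 0 - 1 else if i ≤ c then s (i - 1) else s i, ?_, ?_⟩
    · intro i hi
      dsimp only
      rw [if_neg (Nat.succ_ne_zero i)]
      split_ifs with h1 h2 h2 h3
      · subst h1
        simp
      · omega
      · exact hs.lt (by omega) (by omega)
      · exact hs.lt (by omega) (by omega)
      · omega
      · exact hs i hi
    · rw [sum_range_succ']
      refine lt_add_of_lt_of_nonneg (sum_lt_sum (fun i hi ↦ ?_) ⟨a, mem_range.2 (by omega), ?_⟩)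
        (mul_nonneg (hg.pos 0 (by omega)).le (hψ _))
      · beta_reduce
        rw [if_neg (Nat.succ_ne_zero i)]
        split_ifs with h1 h2 h2
        · rw [hφ, Nat.add_sub_cancel]
          exact mul_le_mul_of_nonneg_right (h i h1).le (hψ _)
        · omega
        · omega
        · rw [hφ]
      · beta_reduce
        rw [if_pos hac, if_neg (Nat.succ_ne_zero a), if_pos (by omega), Nat.add_sub_cancel, ← hφ]
        exact mul_lt_mul_of_pos_right (h a hac) ha0
  · refine ⟨fun i ↦ if i < c then s i else if i < m then s (i + 1) else s m + 1, ?_, ?_⟩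
    · intro i hi
      dsimp only
      split_ifs with h1 h2 h3 h3 h4
      · exact hs i hi
      · exact hs.lt (by omega) (by omega)
      · omega
      · omega
      · exact hs _ (by omega)
      · rw [show i + 1 = m by omega]
        linarith
    · rw [sum_range_succ]
      refine lt_add_of_lt_of_nonneg
        (sum_lt_sum (fun i hi ↦ ?_) ⟨b - 1, mem_range.2 (by omega), ?_⟩)
        (mul_nonneg (hg.pos m le_rfl).le (hψ _))
      · rw [mem_range] at hi
        beta_reduce
        rw [if_pos hi]
        split_ifs with h1
        · rw [hφ]
        · rw [hφ]
          exact mul_le_mul_of_nonneg_right (h i (by omega) hi).le (hψ _)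
      · have hlt := h (b - 1) (by omega) (by omega)
        beta_reduce
        rw [if_neg (by omega), if_neg (by omega), if_pos (by omega), ← hφ]
        rw [Nat.sub_add_cancel (by omega)] at hlt ⊢
        exact mul_lt_mul_of_pos_right hlt hb0

lemma matchedWeight_eq_sum_mul (ℓ m : ℕ) (f g r s : ℕ → ℝ) :
    matchedWeight ℓ m f g r s =
      ∑ j ∈ range (m + 1), g j * ∑ k ∈ range (ℓ + 1), if r k = s j then f k else 0 := by
  unfold matchedWeight
  rw [sum_comm]
  refine sum_congr rfl fun j _ ↦ ?_
  rw [mul_sum]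
  refine sum_congr rfl fun k _ ↦ ?_
  split_ifs
  · exact mul_comm _ _
  · exact (mul_zero _).symm

/-- In an optimal pair, an index of `s` between two matched indices is matched. -/
lemma IsOptimal.exists_eq_right {ℓ m : ℕ} {f g r s : ℕ → ℝ} (h : IsOptimal ℓ m f g r s)
    (hf : StrictlyUnimodal ℓ f) (hg : StrictlyUnimodal m g) {a b c k₁ k₂ : ℕ} (hac : a < c)
    (hcb : c < b) (hb : b ≤ m) (hk₁ : k₁ ≤ ℓ) (hk₂ : k₂ ≤ ℓ) (ha : r k₁ = s a) (hb' : r k₂ = s b) :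
    ∃ k ≤ ℓ, r k = s c := by
  by_contra! hc
  have nonneg : ∀ y : ℝ, ∀ k ∈ range (ℓ + 1), 0 ≤ if r k = y then f k else 0 := by
    intro y k hk
    have := hf.pos k (by rw [mem_range] at hk; omega)
    positivity
  have pos : ∀ j, ∀ k ≤ ℓ, r k = s j → 0 < ∑ k ∈ range (ℓ + 1), if r k = s j then f k else 0 := by
    intro j k hk e
    refine sum_pos' (nonneg _) ⟨k, mem_range.2 (by omega), ?_⟩
    rw [if_pos e]
    exact hf.pos k hk
  obtain ⟨s', hs', hlt⟩ := exists_sum_lt_of_gap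
    (ψ := fun y ↦ ∑ k ∈ range (ℓ + 1), if r k = y then f k else 0) hg h.right (fun _ ↦ rfl)
    (fun y ↦ sum_nonneg (nonneg y)) hac hcb hb (pos a k₁ hk₁ ha)
    (sum_eq_zero fun k hk ↦ if_neg (hc k (by rw [mem_range] at hk; omega))) (pos b k₂ hk₂ hb')
  have := h.max r s' h.left hs'
  rw [matchedWeight_eq_sum_mul, matchedWeight_eq_sum_mul] at this
  exact this.not_gt hlt

/-- In an optimal pair, the last match uses the last index of `r` or of `s`. -/
lemma IsOptimal.exists_eq_above {ℓ m : ℕ} {f g r s : ℕ → ℝ} (h : IsOptimal ℓ m f g r s)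
    (hf : StrictlyUnimodal ℓ f) (hg : StrictlyUnimodal m g) {k j : ℕ} (hk : k < ℓ) (hj : j < m)
    (hkj : r k = s j) : ∃ k' j', k < k' ∧ k' ≤ ℓ ∧ j < j' ∧ j' ≤ m ∧ r k' = s j' := by
  by_contra! hno
  have below : ∀ k' ≤ ℓ, ∀ j' ≤ m, r k' = s j' → k' ≤ k ∧ j' ≤ j := by
    intro k' hk' j' hj' e
    have h1 := h.left.lt_iff hk.le hk'
    have h2 := h.right.lt_iff hj.le hj'
    rw [hkj, e, h2] at h1
    by_cases hlt : k < k'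
    · exact absurd e (hno k' j' hlt hk' (h1.2 hlt) hj')
    · omega
  refine (h.max _ _ (h.left.extend k) (h.right.extend j)).not_gt ?_
  unfold matchedWeight
  rw [← sum_product', ← sum_product']
  refine sum_lt_sum ?_ ⟨(k + 1, j + 1), ?_, ?_⟩
  · rintro ⟨k', j'⟩ hmem
    simp only [mem_product, mem_range, Nat.lt_succ_iff] at hmem
    have hpos := mul_pos (hf.pos k' hmem.1) (hg.pos j' hmem.2)
    dsimp only
    by_cases e : r k' = s j'
    · obtain ⟨h1, h2⟩ := below k' hmem.1 j' hmem.2 e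
      simp only [if_pos h1, if_pos h2, le_refl]
    · rw [if_neg e]
      positivity
  · simp only [mem_product, mem_range]
    omega
  · have e : r (k + 1) ≠ s (j + 1) := hno _ _ (by omega) (by omega) (by omega) (by omega)
    dsimp only
    rw [if_neg e, if_pos]
    · exact mul_pos (hf.pos _ hk) (hg.pos _ hj)
    · rw [if_neg (by omega : ¬k + 1 ≤ k), if_neg (by omega : ¬j + 1 ≤ j), hkj]
      push_cast
      ring

lemma IsOptimal.eq_succ {ℓ m : ℕ} {f g r s : ℕ → ℝ} (h : IsOptimal ℓ m f g r s)
    (hf : StrictlyUnimodal ℓ f) (hg : StrictlyUnimodal m g) {k j : ℕ} (hk : k < ℓ) (hj : j < m)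
    (hkj : r k = s j) : r (k + 1) = s (j + 1) := by
  obtain ⟨k', j', hk', hk'ℓ, hj', hj'm, e⟩ := h.exists_eq_above hf hg hk hj hkj
  have matched_right : ∃ a ≤ ℓ, r a = s (j + 1) := by
    rcases (show j + 1 ≤ j' from hj').eq_or_lt with rfl | hlt
    · exact ⟨k', hk'ℓ, e⟩
    · exact h.exists_eq_right hf hg (Nat.lt_succ_self j) hlt hj'm hk.le hk'ℓ hkj e
  have matched_left : ∃ b ≤ m, s b = r (k + 1) := by
    rcases (show k + 1 ≤ k' from hk').eq_or_lt with rfl | hlt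
    · exact ⟨j', hj'm, e.symm⟩
    · exact h.swap.exists_eq_right hg hf (Nat.lt_succ_self k) hlt hk'ℓ hj.le hj'm hkj.symm e.symm
  obtain ⟨a, ha, ea⟩ := matched_right
  obtain ⟨b, hb, eb⟩ := matched_left
  refine le_antisymm ?_ ?_
  · have hka : k < a := by
      rw [← h.left.lt_iff hk.le ha, hkj, ea]
      exact h.right j hj
    rw [← ea]
    by_contra! hlt
    rw [h.left.lt_iff ha hk] at hlt
    omega
  · have hjb : j < b := by
      rw [← h.right.lt_iff hj.le hb, ← hkj, eb]
      exact h.left k hk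
    rw [← eb]
    by_contra! hlt
    rw [h.right.lt_iff hb hj] at hlt
    omega

lemma IsOptimal.eq_add {ℓ m : ℕ} {f g r s : ℕ → ℝ} (h : IsOptimal ℓ m f g r s)
    (hf : StrictlyUnimodal ℓ f) (hg : StrictlyUnimodal m g) {k j : ℕ} (hkj : r k = s j) (d : ℕ)
    (hk : k + d ≤ ℓ) (hj : j + d ≤ m) : r (k + d) = s (j + d) := by
  induction d with
  | zero => exact hkj
  | succ d ih =>
    exact h.eq_succ hf hg (k := k + d) (j := j + d) hk hj (ih (by omega) (by omega))

lemma IsOptimal.eq_sub {ℓ m : ℕ} {f g r s : ℕ → ℝ} (h : IsOptimal ℓ m f g r s)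
    (hf : StrictlyUnimodal ℓ f) (hg : StrictlyUnimodal m g) {k j : ℕ} (d : ℕ)
    (hk : k + d ≤ ℓ) (hj : j + d ≤ m) (hkj : r (k + d) = s (j + d)) : r k = s j := by
  have := h.reflect.eq_add hf.reflect hg.reflect (k := ℓ - (k + d)) (j := m - (j + d))
    (by simp only [show ℓ - (ℓ - (k + d)) = k + d by omega,
      show m - (m - (j + d)) = j + d by omega, hkj]) d (by omega) (by omega)
  simpa only [neg_inj, show ℓ - (ℓ - (k + d) + d) = k by omega,
    show m - (m - (j + d) + d) = j by omega] using this

/-- if `(r, s)` maximizes `F` over pairs of strictly increasing tuples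
and `r_k = s_j + x` for some `k, j`, then `r_{k'} = s_{j'} + x` for all indices
with `k' - j' = k - j`. -/
theorem stmt_5 (p : ℝ) (hp0 : 0 < p) (hp1 : p < 1) (ℓ m : ℕ) (x : ℝ)
    (r s : ℕ → ℝ)
    (hr : ∀ k, k < ℓ → r k < r (k + 1)) (hs : ∀ j, j < m → s j < s (j + 1))
    (hmax : ∀ r' s' : ℕ → ℝ, (∀ k, k < ℓ → r' k < r' (k + 1)) →
      (∀ j, j < m → s' j < s' (j + 1)) → F ℓ m p x r' s' ≤ F ℓ m p x r s)
    (k j : ℕ) (hk : k ≤ ℓ) (hj : j ≤ m) (hkj : r k = s j + x) :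
    ∀ k' j' : ℕ, k' ≤ ℓ → j' ≤ m → (k' : ℤ) - (j' : ℤ) = (k : ℤ) - (j : ℤ) →
      r k' = s j' + x := by
  have hopt : IsOptimal ℓ m (fun i ↦ (ℓ.choose i : ℝ) * p ^ i * (1 - p) ^ (ℓ - i))
      (fun i ↦ (m.choose i : ℝ) * p ^ i * (1 - p) ^ (m - i)) r (fun i ↦ s i + x) := by
    refine ⟨hr, fun i hi ↦ add_lt_add_left (hs i hi) x, fun r' s' hr' hs' ↦ ?_⟩
    have := hmax r' (fun i ↦ s' i - x) hr' fun i hi ↦ sub_lt_sub_right (hs' i hi) x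
    simpa only [F, matchedWeight, sub_add_cancel] using this
  have hf := strictlyUnimodal_binomial ℓ hp0 hp1
  have hg := strictlyUnimodal_binomial m hp0 hp1
  intro k' j' hk' hj' hdiff
  rcases le_total k k' with hle | hle
  · obtain ⟨d, rfl⟩ := Nat.exists_eq_add_of_le hle
    obtain rfl : j' = j + d := by omega
    exact hopt.eq_add hf hg hkj d hk' hj'
  · obtain ⟨d, rfl⟩ := Nat.exists_eq_add_of_le hle
    obtain rfl : j = j' + d := by omega
    exact hopt.eq_sub hf hg d hk hj hkj
end

section
/- Let n be an even positive integer, let p be a real with 0 ≤ p ≤ 1, and let a_1, …, a_n be nonzero reals. Then for every x ∈ ℝ, P(a; p; x) ≤ D(n/2, n/2, p, 0) = Σ_{k=0}^{n/2} C(n/2, k)^2 p^{2k} (1−p)^{n−2k}. That is, for even n the concentration probability is maximized when exactly half of the coefficients a_i equal 1 and the other half equal −1, at the point x = 0. -/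
open Finset

/-- Discrete Fourier inversion on `ZMod N`, evaluated at a point. -/
lemma sum_stdAddChar_mul (N : ℕ) [NeZero N] (z : ZMod N) :
    ∑ t : ZMod N, ZMod.stdAddChar (t * z) = if z = 0 then (N : ℂ) else 0 := by
  have h := AddChar.sum_mulShift z (ZMod.isPrimitive_stdAddChar N)
  rw [h, ZMod.card]
  split_ifs <;> simp

lemma stdAddChar_sum {ι : Type*} (N : ℕ) [NeZero N] (s : Finset ι) (f : ι → ZMod N) :
    ZMod.stdAddChar (∑ i ∈ s, f i) = ∏ i ∈ s, ZMod.stdAddChar (f i) := by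
  classical
  induction s using Finset.induction_on with
  | empty => simp
  | insert i s hi ih => rw [sum_insert hi, prod_insert hi, AddChar.map_add_eq_mul, ih]

lemma prod_le_average_pow_card {ι : Type*} (s : Finset ι) (hs : s.Nonempty) (z : ι → ℝ)
    (hz : ∀ i ∈ s, 0 ≤ z i) :
    ∏ i ∈ s, z i ≤ ∑ i ∈ s, (#s : ℝ)⁻¹ * z i ^ #s := by
  have hc : (#s : ℝ) ≠ 0 := by exact_mod_cast hs.card_pos.ne'
  have h := Real.geom_mean_le_arith_mean_weighted s (fun _ ↦ (#s : ℝ)⁻¹) (fun i ↦ z i ^ #s)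
    (fun _ _ ↦ by positivity) (by simp [hc]) (fun i hi ↦ pow_nonneg (hz i hi) _)
  refine le_trans (le_of_eq (prod_congr rfl fun i hi ↦ ?_)) h
  exact (Real.pow_rpow_inv_natCast (hz i hi) hs.card_pos.ne').symm

/-- The characteristic function of a Bernoulli variable on `ZMod N`. -/
noncomputable def bernoulliChar (N : ℕ) [NeZero N] (p : ℝ) (t : ZMod N) : ℂ :=
  p * ZMod.stdAddChar t + (1 - p)

lemma bernoulliChar_neg (N : ℕ) [NeZero N] (p : ℝ) (t : ZMod N) :
    bernoulliChar N p (-t) = starRingEnd ℂ (bernoulliChar N p t) := by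
  simp [bernoulliChar, AddChar.map_neg_eq_conj]

lemma bernoulliChar_mul_neg (N : ℕ) [NeZero N] (p : ℝ) (t : ZMod N) :
    bernoulliChar N p t * bernoulliChar N p (-t) = ((‖bernoulliChar N p t‖ ^ 2 : ℝ) : ℂ) := by
  rw [bernoulliChar_neg, Complex.mul_conj, Complex.normSq_eq_norm_sq]

lemma card_mul_sum_ite_eq (N n : ℕ) [NeZero N] (b : Fin n → ZMod N) (p : ℝ) (y : ZMod N) :
    (N : ℂ) * ((∑ S : Finset (Fin n),
      if ∑ i ∈ S, b i = y then p ^ #S * (1 - p) ^ (n - #S) else 0 : ℝ) : ℂ) =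
    ∑ t : ZMod N, ZMod.stdAddChar (-(t * y)) * ∏ i, bernoulliChar N p (t * b i) := by
  have h (t : ZMod N) : ZMod.stdAddChar (-(t * y)) * ∏ i, bernoulliChar N p (t * b i) =
      ∑ S : Finset (Fin n), ((p : ℂ) ^ #S * (1 - p) ^ (n - #S)) *
        ZMod.stdAddChar (t * (∑ i ∈ S, b i - y)) := by
    simp only [bernoulliChar, Fintype.prod_add, mul_sum]
    refine sum_congr rfl fun S _ ↦ ?_
    rw [prod_mul_distrib, prod_const, prod_const, card_compl, Fintype.card_fin, mul_sub,
      sub_eq_add_neg (t * _), AddChar.map_add_eq_mul, mul_sum, stdAddChar_sum]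
    ring
  simp_rw [h]
  rw [sum_comm]
  simp_rw [← mul_sum, sum_stdAddChar_mul, sub_eq_zero]
  push_cast
  rw [mul_sum]
  refine sum_congr rfl fun S _ ↦ ?_
  split_ifs <;> simp [mul_comm]

lemma card_mul_D (N m : ℕ) [NeZero N] (hN : m < N) (p : ℝ) :
    (N : ℝ) * D m m p 0 = ∑ t : ZMod N, ‖bernoulliChar N p t‖ ^ (2 * m) := by
  have h (t : ZMod N) : ((‖bernoulliChar N p t‖ ^ (2 * m) : ℝ) : ℂ) =
      ∑ k ∈ range (m + 1), ∑ j ∈ range (m + 1),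
        ((m.choose k : ℂ) * (m.choose j : ℂ) * p ^ (k + j) * (1 - p) ^ ((m - k) + (m - j))) *
          ZMod.stdAddChar (t * ((k : ZMod N) - (j : ZMod N))) := by
    rw [pow_mul, Complex.ofReal_pow, ← bernoulliChar_mul_neg, mul_pow, bernoulliChar,
      bernoulliChar, add_pow, add_pow, sum_mul_sum]
    refine sum_congr rfl fun k _ ↦ sum_congr rfl fun j _ ↦ ?_
    have e : t * ((k : ZMod N) - (j : ZMod N)) = k • t + j • (-t) := by
      simp only [nsmul_eq_mul]; ring
    rw [e, AddChar.map_add_eq_mul, AddChar.map_nsmul_eq_pow, AddChar.map_nsmul_eq_pow]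
    ring
  apply Complex.ofReal_injective
  rw [Complex.ofReal_sum]
  simp_rw [h]
  rw [sum_comm]
  simp_rw [sum_comm (s := (univ : Finset (ZMod N))), ← mul_sum, sum_stdAddChar_mul]
  simp only [D]
  push_cast
  simp_rw [mul_sum]
  refine sum_congr rfl fun k hk ↦ sum_congr rfl fun j hj ↦ ?_
  have e : ((k : ZMod N) - (j : ZMod N) = 0) ↔ ((k : ℤ) - (j : ℤ) = 0) := by
    rw [mem_range] at hk hj
    rw [sub_eq_zero, sub_eq_zero, ZMod.natCast_eq_natCast_iff', Nat.mod_eq_of_lt (by omega),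
      Nat.mod_eq_of_lt (by omega), Nat.cast_inj]
  simp only [e]
  split_ifs <;> simp [mul_comm]

/-- The extremal bound for nonzero coefficients in a prime field. -/
lemma sum_ite_le_D (N m : ℕ) [Fact N.Prime] (hm : 0 < m) (hN : m < N) (p : ℝ)
    (b : Fin (2 * m) → ZMod N) (hb : ∀ i, b i ≠ 0) (y : ZMod N) :
    (∑ S : Finset (Fin (2 * m)),
      if ∑ i ∈ S, b i = y then p ^ #S * (1 - p) ^ (2 * m - #S) else 0) ≤ D m m p 0 := by
  have hN0 : (0 : ℝ) < N := by exact_mod_cast (Fact.out : N.Prime).pos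
  have : Nonempty (Fin (2 * m)) := ⟨⟨0, by omega⟩⟩
  refine le_of_mul_le_mul_left ?_ hN0
  set A := ∑ S : Finset (Fin (2 * m)),
      if ∑ i ∈ S, b i = y then p ^ #S * (1 - p) ^ (2 * m - #S) else 0 with hA
  have key := card_mul_sum_ite_eq N (2 * m) b p y
  rw [← hA] at key
  calc (N : ℝ) * A ≤ ‖(N : ℂ) * (A : ℂ)‖ := by
        rw [← Complex.ofReal_natCast, ← Complex.ofReal_mul, Complex.norm_real]
        exact le_abs_self _
    _ ≤ ∑ t : ZMod N, ∏ i, ‖bernoulliChar N p (t * b i)‖ := by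
        rw [key]
        refine (norm_sum_le _ _).trans (sum_le_sum fun t _ ↦ ?_)
        rw [norm_mul, AddChar.norm_apply, one_mul, norm_prod]
    _ ≤ ∑ t : ZMod N, ∑ i : Fin (2 * m),
          ((2 * m : ℕ) : ℝ)⁻¹ * ‖bernoulliChar N p (t * b i)‖ ^ (2 * m) := by
        refine sum_le_sum fun t _ ↦ ?_
        simpa using prod_le_average_pow_card univ univ_nonempty
          (fun i ↦ ‖bernoulliChar N p (t * b i)‖) (fun _ _ ↦ norm_nonneg _)
    _ = (N : ℝ) * D m m p 0 := by
        rw [sum_comm, card_mul_D N m hN]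
        have (i : Fin (2 * m)) : ∑ t : ZMod N, ‖bernoulliChar N p (t * b i)‖ ^ (2 * m) =
            ∑ t : ZMod N, ‖bernoulliChar N p t‖ ^ (2 * m) :=
          Equiv.sum_comp (Equiv.mulRight₀ (b i) (hb i)) fun t ↦ ‖bernoulliChar N p t‖ ^ (2 * m)
        simp_rw [← mul_sum, this, sum_const, card_univ, Fintype.card_fin]
        rw [nsmul_eq_mul, inv_mul_cancel_left₀ (by positivity)]

/-- Finitely many nonzero reals, together with a target, can be replaced by nonzero integers
so that all subset-sum identities persist. -/
lemma exists_int_coefficients (n : ℕ) (a : Fin n → ℝ) (ha : ∀ i, a i ≠ 0) (x : ℝ) :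
    ∃ (c : Fin n → ℤ) (y : ℤ), (∀ i, c i ≠ 0) ∧
      ∀ S : Finset (Fin n), ∑ i ∈ S, a i = x → ∑ i ∈ S, c i = y := by
  obtain ⟨f, hf⟩ := Module.exists_dual_forall_apply_ne_zero (K := ℚ) a ha
  obtain ⟨b, hb⟩ := IsLocalization.exist_integer_multiples_of_finite (nonZeroDivisors ℤ)
    (fun i : Option (Fin n) ↦ f (i.elim x a))
  choose g hg using hb
  have hb0 : ((b : ℤ) : ℚ) ≠ 0 := by exact_mod_cast nonZeroDivisors.coe_ne_zero b
  simp only [zsmul_eq_mul, algebraMap_int_eq, eq_intCast] at hg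
  refine ⟨fun i ↦ g (some i), g none, fun i h ↦ ?_, fun S hS ↦ ?_⟩
  · have := hg (some i)
    rw [show g (some i) = 0 from h, Int.cast_zero] at this
    exact mul_ne_zero hb0 (hf i) this.symm
  · have : ((∑ i ∈ S, g (some i) : ℤ) : ℚ) = (g none : ℚ) := by
      push_cast
      simp only [hg, Option.elim]
      rw [← mul_sum, ← map_sum, hS]
    exact_mod_cast this

/-- for even `n`, the point probability is at most
`Pr(Bin(n/2,p) - Bin(n/2,p) = 0) = Σ_k C(n/2,k)² p^(2k) (1-p)^(n-2k)`. -/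
theorem stmt_8 (n : ℕ) (hn : 0 < n) (hne : Even n) (p : ℝ) (hp0 : 0 ≤ p) (hp1 : p ≤ 1)
    (a : Fin n → ℝ) (ha : ∀ i, a i ≠ 0) (x : ℝ) :
    P n a p x ≤ D (n / 2) (n / 2) p 0 ∧
    D (n / 2) (n / 2) p 0 =
      ∑ k ∈ Finset.range (n / 2 + 1),
        ((n / 2).choose k : ℝ) ^ 2 * p ^ (2 * k) * (1 - p) ^ (n - 2 * k) := by
  obtain ⟨m, rfl⟩ := hne.two_dvd
  have hm : 0 < m := by omega
  rw [Nat.mul_div_cancel_left m two_pos]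
  constructor
  · obtain ⟨c, y, hc, hS⟩ := exists_int_coefficients (2 * m) a ha x
    obtain ⟨N, hN, hprime⟩ := Nat.exists_infinite_primes (m + 1 + ∑ i, (c i).natAbs)
    have : Fact N.Prime := ⟨hprime⟩
    refine le_trans (sum_le_sum fun S _ ↦ ?_)
      (sum_ite_le_D N m hm (by omega) p (fun i ↦ (c i : ZMod N)) (fun i h ↦ ?_) y)
    · by_cases h : ∑ i ∈ S, a i = x
      · have h' : ∑ i ∈ S, (c i : ZMod N) = y := by exact_mod_cast congrArg _ (hS S h)
        rw [if_pos h, if_pos h']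
      · rw [if_neg h]
        have : 0 ≤ 1 - p := by linarith
        split_ifs <;> positivity
    · rw [ZMod.intCast_zmod_eq_zero_iff_dvd, Int.natCast_dvd] at h
      have h1 := Nat.le_of_dvd (Int.natAbs_pos.mpr (hc i)) h
      have h2 := single_le_sum (f := fun i ↦ (c i).natAbs) (fun _ _ ↦ Nat.zero_le _) (mem_univ i)
      omega
  · refine sum_congr rfl fun k hk ↦ ?_
    rw [sum_eq_single_of_mem k hk fun j _ hj ↦ if_neg (by omega), if_pos (sub_self _)]
    rw [show m - k + (m - k) = 2 * m - 2 * k by omega]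
    ring
end

section
/- Let n be a positive integer and let p be a real with 0 ≤ p ≤ 1 − (1/2)^{1/n}. Then for every integer ℓ with 0 ≤ ℓ ≤ n and every integer y, D(ℓ, n−ℓ, p, y) ≤ D(⌈n/2⌉, ⌊n/2⌋, p, 0). That is, when p is this small, the concentration probability over signings of ±1 coefficients is maximized by taking ⌈n/2⌉ coefficients equal to 1 and the rest equal to −1, at the point x = 0. -/
open Finset

theorem choose_succ_mul_choose_le {a b : ℕ} (h : b ≤ a) (k : ℕ) :
    (a + 1).choose k * b.choose k ≤ a.choose k * (b + 1).choose k := by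
  rcases lt_or_ge b k with hk | hk
  · simp [Nat.choose_eq_zero_of_lt hk]
  obtain ⟨c, rfl⟩ := Nat.exists_eq_add_of_le hk
  obtain ⟨d, rfl⟩ := Nat.exists_eq_add_of_le h
  have hA := Nat.choose_mul_succ_eq (k + c + d) k
  have hB := Nat.choose_mul_succ_eq (k + c) k
  rw [show k + c + d + 1 - k = c + d + 1 by omega] at hA
  rw [show k + c + 1 - k = c + 1 by omega] at hB
  generalize (k + c + d + 1).choose k = A' at *
  generalize (k + c + d).choose k = A at *
  generalize (k + c + 1).choose k = B' at *
  generalize (k + c).choose k = B at *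
  have hpos : 0 < (c + d + 1) * (k + c + 1) := by positivity
  refine le_of_mul_le_mul_right ?_ hpos
  calc A' * B * ((c + d + 1) * (k + c + 1))
      = (A' * (c + d + 1)) * (B * (k + c + 1)) := by ring
    _ = (A * (k + c + d + 1)) * (B' * (c + 1)) := by rw [hA, hB]
    _ = A * B' * ((k + c + d + 1) * (c + 1)) := by ring
    _ ≤ A * B' * ((c + d + 1) * (k + c + 1)) := by
      refine Nat.mul_le_mul_left _ ?_
      nlinarith [Nat.zero_le (k * d)]

theorem choose_add_mul_choose_le (k d b : ℕ) :
    (b + d).choose k * b.choose k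
      ≤ ((2 * b + d + 1) / 2).choose k * ((2 * b + d) / 2).choose k := by
  induction d using Nat.twoStepInduction generalizing b with
  | zero =>
    rw [show (2 * b + 0 + 1) / 2 = b by omega, show (2 * b + 0) / 2 = b by omega, add_zero]
  | one =>
    rw [show (2 * b + 1 + 1) / 2 = b + 1 by omega, show (2 * b + 1) / 2 = b by omega]
  | more d ih _ =>
    have h := choose_succ_mul_choose_le (show b ≤ b + d + 1 by omega) k
    have h' := ih (b + 1)
    rw [show b + 1 + d = b + d + 1 by ring,
      show 2 * (b + 1) + d = 2 * b + (d + 2) by ring] at h'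
    exact h.trans h'

theorem choose_mul_choose_le_balanced (k ℓ m : ℕ) :
    ℓ.choose k * m.choose k ≤ ((ℓ + m + 1) / 2).choose k * ((ℓ + m) / 2).choose k := by
  rcases le_total m ℓ with h | h
  · obtain ⟨d, rfl⟩ := Nat.exists_eq_add_of_le h
    convert choose_add_mul_choose_le k d m using 4 <;> ring
  · obtain ⟨d, rfl⟩ := Nat.exists_eq_add_of_le h
    rw [mul_comm]
    convert choose_add_mul_choose_le k d ℓ using 4 <;> ring

theorem D_zero_eq_sum (ℓ m : ℕ) (p : ℝ) :
    D ℓ m p 0 = ∑ k ∈ range (ℓ + m + 1),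
      ((ℓ.choose k * m.choose k : ℕ) : ℝ) * (p ^ (2 * k) * (1 - p) ^ (ℓ + m - 2 * k)) := by
  have hsub : range (ℓ + 1) ⊆ range (ℓ + m + 1) := range_subset_range.2 (by omega)
  rw [← sum_subset hsub]
  · refine sum_congr rfl fun k hk => ?_
    simp only [sub_eq_zero, Nat.cast_inj, sum_ite_eq, mem_range] at hk ⊢
    split_ifs with hm
    · rw [show ℓ - k + (m - k) = ℓ + m - 2 * k by omega, ← two_mul]
      push_cast
      ring
    · rw [Nat.choose_eq_zero_of_lt (show m < k by omega)]
      simp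
  · intro k _ hk
    rw [mem_range] at hk
    rw [Nat.choose_eq_zero_of_lt (show ℓ < k by omega)]
    simp

theorem D_zero_le_balanced (ℓ m : ℕ) {p : ℝ} (hp0 : 0 ≤ p) (hp1 : p ≤ 1) :
    D ℓ m p 0 ≤ D ((ℓ + m + 1) / 2) ((ℓ + m) / 2) p 0 := by
  rw [D_zero_eq_sum, D_zero_eq_sum, show (ℓ + m + 1) / 2 + (ℓ + m) / 2 = ℓ + m by omega]
  have hq : 0 ≤ 1 - p := sub_nonneg.2 hp1
  refine sum_le_sum fun k _ => mul_le_mul_of_nonneg_right ?_ (by positivity)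
  exact_mod_cast choose_mul_choose_le_balanced k ℓ m

theorem pow_le_D_zero (ℓ m : ℕ) {p : ℝ} (hp0 : 0 ≤ p) (hp1 : p ≤ 1) :
    (1 - p) ^ (ℓ + m) ≤ D ℓ m p 0 := by
  have hq : 0 ≤ 1 - p := sub_nonneg.2 hp1
  rw [D_zero_eq_sum]
  refine le_trans (by simp) (single_le_sum (f := fun k =>
    ((ℓ.choose k * m.choose k : ℕ) : ℝ) * (p ^ (2 * k) * (1 - p) ^ (ℓ + m - 2 * k)))
    (fun k _ => by positivity) (mem_range.2 (Nat.succ_pos (ℓ + m))))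

theorem sum_binomial_mul_binomial (ℓ m : ℕ) (p : ℝ) :
    ∑ k ∈ range (ℓ + 1), ∑ j ∈ range (m + 1),
      (ℓ.choose k : ℝ) * (m.choose j : ℝ) * p ^ (k + j) * (1 - p) ^ ((ℓ - k) + (m - j)) = 1 := by
  have h : ∀ i : ℕ, ∑ k ∈ range (i + 1), p ^ k * (1 - p) ^ (i - k) * (i.choose k : ℝ) = 1 := by
    intro i
    rw [← add_pow]
    simp
  calc _ = (∑ k ∈ range (ℓ + 1), p ^ k * (1 - p) ^ (ℓ - k) * (ℓ.choose k : ℝ)) *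
        ∑ j ∈ range (m + 1), p ^ j * (1 - p) ^ (m - j) * (m.choose j : ℝ) := by
        rw [sum_mul_sum]
        refine sum_congr rfl fun k _ => sum_congr rfl fun j _ => ?_
        ring
    _ = 1 := by rw [h, h, one_mul]

theorem D_add_D_zero_le_one (ℓ m : ℕ) {p : ℝ} (hp0 : 0 ≤ p) (hp1 : p ≤ 1) {y : ℤ}
    (hy : y ≠ 0) : D ℓ m p y + D ℓ m p 0 ≤ 1 := by
  have hq : 0 ≤ 1 - p := sub_nonneg.2 hp1
  rw [← sum_binomial_mul_binomial ℓ m p]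
  simp only [D, ← sum_add_distrib]
  refine sum_le_sum fun k _ => sum_le_sum fun j _ => ?_
  have h : 0 ≤ (ℓ.choose k : ℝ) * (m.choose j : ℝ) * p ^ (k + j) *
      (1 - p) ^ ((ℓ - k) + (m - j)) := by positivity
  split_ifs with h1 h2
  · exact absurd (h1.symm.trans h2) hy
  all_goals linarith

/-- if `p ≤ 1 - (1/2)^(1/n)`, then among ±1 signings the concentration
probability is maximized with `⌈n/2⌉` coefficients equal to `1`, at the point `0`. -/
theorem stmt_9 (n : ℕ) (hn : 0 < n) (p : ℝ) (hp0 : 0 ≤ p)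
    (hp1 : p ≤ 1 - (1 / 2 : ℝ) ^ ((1 : ℝ) / (n : ℝ))) :
    ∀ ℓ : ℕ, ℓ ≤ n → ∀ y : ℤ,
      D ℓ (n - ℓ) p y ≤ D ((n + 1) / 2) (n / 2) p 0 := by
  intro ℓ hℓ y
  have hr : (0 : ℝ) ≤ (1 / 2 : ℝ) ^ ((1 : ℝ) / (n : ℝ)) := by positivity
  have hp : p ≤ 1 := by linarith
  have hbal := D_zero_le_balanced ℓ (n - ℓ) hp0 hp
  rw [Nat.add_sub_cancel' hℓ] at hbal
  rcases eq_or_ne y 0 with rfl | hy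
  · exact hbal
  have hhalf : (1 / 2 : ℝ) ≤ (1 - p) ^ n := by
    calc (1 / 2 : ℝ) = ((1 / 2 : ℝ) ^ ((1 : ℝ) / (n : ℝ))) ^ n := by
          rw [one_div (n : ℝ), Real.rpow_inv_natCast_pow (by norm_num) hn.ne']
      _ ≤ (1 - p) ^ n := pow_le_pow_left₀ hr (by linarith) n
  have hlow := pow_le_D_zero ℓ (n - ℓ) hp0 hp
  rw [Nat.add_sub_cancel' hℓ] at hlow
  have hone := D_add_D_zero_le_one ℓ (n - ℓ) hp0 hp hy
  linarith
end
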